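/- arXiv:2305.18016 — 2 statements merged into one kernel-verified Lean document; each statement's English description precedes it below -/
import Mathlib

section
/- Let Ω be a bounded domain in ℝ^m with infinitely smooth boundary. Let B be a non-negative injective compact operator on L²(Ω) such that for every f ∈ L²(Ω) the function u = Bf satisfies -Δu = f in the distributional sense (so B is the inverse of a positive well-defined restriction L of the maximal operator generated by -Δ), and suppose lim_{n→∞} s_n(B)/L(n) = a for some slowly varying function L and some 0 < a < ∞. Let K be a bounded operator on L²(Ω) belonging to the Schatten class S_q for some q > 0, whose range is contained in {u ∈ L²(Ω) : Δu = 0 in the distributional sense}. Then the operator B + K has a nonzero eigenvalue; hence the well-defined restriction L_K of the maximal operator, with L_K^{-1} = B + K, is not Volterra. -/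
open Filter Topology MeasureTheory

/-- The `n`-th singular value (`s`-number) of an operator on a Hilbert space,
indexed so that `sNum T 1 = ‖T‖`: `sNum T n` is the distance from `T` to the
operators of rank `< n`. -/
noncomputable def sNum {H : Type*} [NormedAddCommGroup H] [InnerProductSpace ℂ H]
    (T : H →L[ℂ] H) (n : ℕ) : ℝ :=
  ⨅ F : {F : H →L[ℂ] H // Module.rank ℂ (LinearMap.range (F : H →ₗ[ℂ] H)) < (n : Cardinal)},
    ‖T - (F : H →L[ℂ] H)‖

/-- The Laplacian of a test function on `ℝ^m`, as the sum of the second partial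
derivatives in the coordinate directions. -/
noncomputable def testLaplacian {m : ℕ} (φ : EuclideanSpace ℝ (Fin m) → ℂ)
    (x : EuclideanSpace ℝ (Fin m)) : ℂ :=
  ∑ i : Fin m,
    iteratedFDeriv ℝ 2 φ x ![EuclideanSpace.single i 1, EuclideanSpace.single i 1]

/-- `u` is harmonic on `Ω` in the distributional sense: `∫ u Δφ = 0` for every smooth
compactly supported test function `φ` with support in `Ω`. -/
def WeakHarmonicOn {m : ℕ} (Ω : Set (EuclideanSpace ℝ (Fin m)))
    (u : EuclideanSpace ℝ (Fin m) → ℂ) : Prop :=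
  ∀ φ : EuclideanSpace ℝ (Fin m) → ℂ, ContDiff ℝ (⊤ : ℕ∞) φ → HasCompactSupport φ →
    tsupport φ ⊆ Ω → ∫ x in Ω, u x * testLaplacian φ x = 0

/-- `-Δu = f` on `Ω` in the distributional sense: `∫ u Δφ = -∫ f φ` for every smooth
compactly supported test function `φ` with support in `Ω`. -/
def WeakNegLapEq {m : ℕ} (Ω : Set (EuclideanSpace ℝ (Fin m)))
    (u f : EuclideanSpace ℝ (Fin m) → ℂ) : Prop :=
  ∀ φ : EuclideanSpace ℝ (Fin m) → ℂ, ContDiff ℝ (⊤ : ℕ∞) φ → HasCompactSupport φ →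
    tsupport φ ⊆ Ω → ∫ x in Ω, u x * testLaplacian φ x = -∫ x in Ω, f x * φ x

/-- `Ω` has infinitely smooth boundary: every boundary point admits a local smooth
defining function with nonvanishing derivative. -/
def HasSmoothBoundary {m : ℕ} (Ω : Set (EuclideanSpace ℝ (Fin m))) : Prop :=
  ∀ x ∈ frontier Ω, ∃ (U : Set (EuclideanSpace ℝ (Fin m)))
    (ψ : EuclideanSpace ℝ (Fin m) → ℝ), IsOpen U ∧ x ∈ U ∧ ContDiff ℝ (⊤ : ℕ∞) ψ ∧
      (∀ y ∈ U, fderiv ℝ ψ y ≠ 0) ∧ Ω ∩ U = {y ∈ U | ψ y < 0}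

/-- `L : [b, ∞) → ℝ` (with `b > 0`) is slowly varying if it is positive,
continuously differentiable, and `x * L' x / L x → 0` as `x → ∞`. -/
structure SlowlyVarying (b : ℝ) (L : ℝ → ℝ) : Prop where
  b_pos : 0 < b
  pos : ∀ x, b ≤ x → 0 < L x
  contDiff : ContDiffOn ℝ 1 L (Set.Ici b)
  slow : Tendsto (fun x : ℝ => x * deriv L x / L x) atTop (𝓝 0)

section MatrixPart
open Matrix

variable {n : Type*} [Fintype n] [DecidableEq n]

noncomputable def tau (k : ℕ) (S : Matrix n n ℂ) : ℝ := (trace (S ^ (2 ^ k))).re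

lemma tau_sq (k : ℕ) (S : Matrix n n ℂ) : tau k (S ^ 2) = tau (k + 1) S := by
  unfold tau
  rw [← pow_mul, pow_succ' 2 k]

lemma herm_sq_diag {S : Matrix n n ℂ} (hS : S.IsHermitian) (i : n) :
    ((S ^ 2) i i).re = ∑ j, ‖S i j‖ ^ 2 := by
  rw [pow_two, Matrix.mul_apply, Complex.re_sum]
  refine Finset.sum_congr rfl fun j _ => ?_
  rw [← hS.apply j i, Complex.star_def, Complex.mul_conj, Complex.normSq_eq_norm_sq,
    Complex.ofReal_re]

lemma tau_diag (k : ℕ) : ∀ {S : Matrix n n ℂ}, S.IsHermitian →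
    ∑ i, ((S i i).re) ^ (2 ^ k) ≤ tau k S := by
  induction k with
  | zero => intro S hS; simp [tau, trace]
  | succ k ih =>
    intro S hS
    rw [← tau_sq]
    refine le_trans (Finset.sum_le_sum fun i _ => ?_) (ih (hS.pow 2))
    rw [pow_succ' 2 k, pow_mul]
    refine pow_le_pow_left₀ (sq_nonneg _) ?_ _
    rw [herm_sq_diag hS]
    calc (S i i).re ^ 2 ≤ ‖S i i‖ ^ 2 := by
          rw [← sq_abs]; exact pow_le_pow_left₀ (abs_nonneg _) (Complex.abs_re_le_norm _) 2
      _ ≤ _ := Finset.single_le_sum (f := fun j => ‖S i j‖ ^ 2) (fun j _ => sq_nonneg _)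
          (Finset.mem_univ i)

lemma tau_conj (k : ℕ) (S U : Matrix n n ℂ) (hU : U * star U = 1) :
    tau k (star U * S * U) = tau k S := by
  have hU' : star U * U = 1 := mul_eq_one_comm.mp hU
  have h : ∀ m : ℕ, (star U * S * U) ^ m = star U * S ^ m * U := by
    intro m
    induction m with
    | zero => simp [hU']
    | succ m ih =>
      rw [pow_succ, ih, pow_succ]
      calc star U * S ^ m * U * (star U * S * U) = star U * S ^ m * (U * star U) * S * U := by
            simp only [mul_assoc]
        _ = _ := by rw [hU]; simp only [mul_assoc, mul_one]; 
  unfold tau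
  rw [h, Matrix.trace_mul_cycle, hU, one_mul]

lemma exists_diag {S : Matrix n n ℂ} (hS : S.IsHermitian) :
    ∃ U : Matrix n n ℂ, U * star U = 1 ∧
      star U * S * U = diagonal (fun i => (hS.eigenvalues i : ℂ)) := by
  refine ⟨hS.eigenvectorUnitary, ?_, ?_⟩
  · exact Unitary.coe_mul_star_self hS.eigenvectorUnitary
  · have := hS.conjStarAlgAut_star_eigenvectorUnitary
    rw [Unitary.conjStarAlgAut_apply] at this
    simpa [Function.comp_def] using this

lemma tau_diagonal (k : ℕ) (y : n → ℝ) :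
    tau k (diagonal (fun i => (y i : ℂ))) = ∑ i, (y i) ^ (2 ^ k) := by
  unfold tau
  rw [diagonal_pow, trace_diagonal, Complex.re_sum]
  refine Finset.sum_congr rfl fun j _ => ?_
  simp only [Pi.pow_apply]
  rw [← Complex.ofReal_pow, Complex.ofReal_re]

lemma tau_eig (k : ℕ) {S : Matrix n n ℂ} (hS : S.IsHermitian) :
    tau k S = ∑ i, (hS.eigenvalues i) ^ (2 ^ k) := by
  obtain ⟨U, hU, h⟩ := exists_diag hS
  rw [← tau_conj k S U hU, h, tau_diagonal]

lemma tau_nonneg (k : ℕ) {S : Matrix n n ℂ} (hS : S.IsHermitian) : 0 ≤ tau (k+1) S := by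
  rw [tau_eig _ hS]
  refine Finset.sum_nonneg fun i _ => Even.pow_nonneg ?_ _
  exact (Nat.even_pow' (by omega)).2 even_two

lemma star_conj_herm {S : Matrix n n ℂ} (hS : S.IsHermitian) (U : Matrix n n ℂ) :
    (star U * S * U).IsHermitian := by
  rw [star_eq_conjTranspose]; exact isHermitian_conjTranspose_mul_mul U hS

lemma tau_add (k : ℕ) {S S' : Matrix n n ℂ} (hS : S.IsHermitian) (hS' : S'.IsHermitian) :
    tau (k+1) (S + S') ≤ 2 ^ (2 ^ (k+1)) * (tau (k+1) S + tau (k+1) S') := by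
  obtain ⟨U, hU, h⟩ := exists_diag (hS.add hS')
  have e1 := tau_diag (k+1) (star_conj_herm hS U)
  have e2 := tau_diag (k+1) (star_conj_herm hS' U)
  rw [tau_conj _ _ _ hU] at e1 e2
  rw [tau_eig _ (hS.add hS')]
  have hev : Even (2 ^ (k+1)) := (Nat.even_pow' (by omega)).2 even_two
  have hd : ∀ i, (hS.add hS').eigenvalues i =
      ((star U * S * U) i i).re + ((star U * S' * U) i i).re := by
    intro i
    have := congrFun (congrFun h i) i
    rw [diagonal_apply_eq, Matrix.mul_add, Matrix.add_mul, Matrix.add_apply] at this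
    have := congrArg Complex.re this
    rw [Complex.add_re, Complex.ofReal_re] at this
    exact this.symm
  calc _ ≤ ∑ i, 2 ^ (2 ^ (k+1) - 1) * (((star U * S * U) i i).re ^ (2 ^ (k+1))
            + ((star U * S' * U) i i).re ^ (2 ^ (k+1))) := by
        refine Finset.sum_le_sum fun i _ => ?_
        rw [hd i]; exact hev.add_pow_le
    _ = 2 ^ (2 ^ (k+1) - 1) * (∑ i, ((star U * S * U) i i).re ^ (2 ^ (k+1))
            + ∑ i, ((star U * S' * U) i i).re ^ (2 ^ (k+1))) := by
        rw [← Finset.mul_sum, Finset.sum_add_distrib]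
    _ ≤ 2 ^ (2 ^ (k+1) - 1) * (tau (k+1) S + tau (k+1) S') := by gcongr
    _ ≤ _ := by
        have := tau_nonneg k hS
        have := tau_nonneg k hS'
        gcongr
        · norm_num
        · exact Nat.sub_le _ _

lemma tau_smul (k : ℕ) (c : ℝ) (S : Matrix n n ℂ) :
    tau k ((c : ℂ) • S) = c ^ (2 ^ k) * tau k S := by
  unfold tau
  rw [smul_pow, trace_smul, ← Complex.ofReal_pow, smul_eq_mul, Complex.re_ofReal_mul]

lemma tau_mul (k : ℕ) {H Y : Matrix n n ℂ} (hH : H.IsHermitian) (hY : Y.IsHermitian) :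
    tau (k+1) (H * Y + Y * H) ≤
      4 ^ (2 ^ k) * (Real.sqrt (tau (k+2) H) * Real.sqrt (tau (k+2) Y)) := by
  have hZ : (H * Y + Y * H).IsHermitian := by
    unfold Matrix.IsHermitian
    rw [conjTranspose_add, conjTranspose_mul, conjTranspose_mul, hH.eq, hY.eq, add_comm]
  obtain ⟨U, hU, h⟩ := exists_diag hZ
  set H' := star U * H * U with hH'
  set Y' := star U * Y * U with hY'
  have hHh : H'.IsHermitian := star_conj_herm hH U
  have hYh : Y'.IsHermitian := star_conj_herm hY U
  have e1 := tau_diag (k+1) (hHh.pow 2)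
  have e2 := tau_diag (k+1) (hYh.pow 2)
  rw [tau_sq, tau_conj _ _ _ hU] at e1 e2
  have hprod : star U * (H * Y + Y * H) * U = H' * Y' + Y' * H' := by
    have e : ∀ P Q : Matrix n n ℂ, star U * P * U * (star U * Q * U) = star U * (P * Q) * U := by
      intro P Q
      calc star U * P * U * (star U * Q * U) = star U * P * (U * star U) * Q * U := by
            simp only [mul_assoc]
        _ = _ := by rw [hU]; simp only [mul_assoc, mul_one]
    rw [hH', hY', e, e, mul_add, add_mul]
  have hz : ∀ i, (hZ.eigenvalues i) ^ 2 ≤ 4 * (((H' ^ 2) i i).re * ((Y' ^ 2) i i).re) := by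
    intro i
    have h1 := congrFun (congrFun h i) i
    rw [hprod, diagonal_apply_eq, Matrix.add_apply, Matrix.mul_apply, Matrix.mul_apply] at h1
    have h2 : |hZ.eigenvalues i| ≤ 2 * ∑ j, ‖H' i j‖ * ‖Y' i j‖ := by
      rw [← Real.norm_eq_abs, ← Complex.norm_real, ← h1, two_mul]
      refine (norm_add_le _ _).trans (add_le_add ?_ ?_)
      · refine (norm_sum_le _ _).trans (Finset.sum_le_sum fun j _ => ?_)
        rw [norm_mul, ← hYh.apply j i, norm_star]
      · refine (norm_sum_le _ _).trans (Finset.sum_le_sum fun j _ => ?_)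
        rw [norm_mul, ← hHh.apply j i, norm_star, mul_comm]
    rw [herm_sq_diag hHh, herm_sq_diag hYh, ← sq_abs]
    calc _ ≤ (2 * ∑ j, ‖H' i j‖ * ‖Y' i j‖) ^ 2 := pow_le_pow_left₀ (abs_nonneg _) h2 2
      _ = 4 * (∑ j, ‖H' i j‖ * ‖Y' i j‖) ^ 2 := by ring
      _ ≤ _ := by
        gcongr
        exact Finset.sum_mul_sq_le_sq_mul_sq _ _ _
  have p1 : ∀ i, 0 ≤ ((H' ^ 2) i i).re := fun i => by
    rw [herm_sq_diag hHh]; exact Finset.sum_nonneg fun _ _ => sq_nonneg _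
  have p2 : ∀ i, 0 ≤ ((Y' ^ 2) i i).re := fun i => by
    rw [herm_sq_diag hYh]; exact Finset.sum_nonneg fun _ _ => sq_nonneg _
  rw [tau_eig _ hZ]
  calc _ ≤ ∑ i, 4 ^ (2 ^ k) * ((((H' ^ 2) i i).re) ^ (2 ^ k) * (((Y' ^ 2) i i).re) ^ (2 ^ k)) := by
        refine Finset.sum_le_sum fun i _ => ?_
        rw [pow_succ' 2 k, pow_mul, ← mul_pow, ← mul_pow]
        exact pow_le_pow_left₀ (sq_nonneg _) (hz i) _
    _ = 4 ^ (2 ^ k) * ∑ i, ((((H' ^ 2) i i).re) ^ (2 ^ k) * (((Y' ^ 2) i i).re) ^ (2 ^ k)) := by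
        rw [Finset.mul_sum]
    _ ≤ 4 ^ (2 ^ k) * (Real.sqrt (∑ i, ((((H' ^ 2) i i).re) ^ (2 ^ k)) ^ 2) *
          Real.sqrt (∑ i, ((((Y' ^ 2) i i).re) ^ (2 ^ k)) ^ 2)) := by
        gcongr
        exact Real.sum_mul_le_sqrt_mul_sqrt _ _ _
    _ ≤ _ := by
        have hp : ∀ x : ℝ, (x ^ (2 ^ k)) ^ 2 = x ^ (2 ^ (k+1)) := fun x => by
          rw [← pow_mul, ← pow_succ]
        simp only [hp]
        gcongr

end MatrixPart

section Trunc
open Matrix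

def StrictUpper {d : ℕ} (T : Matrix (Fin d) (Fin d) ℂ) : Prop := ∀ i j, j ≤ i → T i j = 0

lemma StrictUpper.sq {d : ℕ} {T : Matrix (Fin d) (Fin d) ℂ} (hT : StrictUpper T) :
    StrictUpper (T ^ 2) := by
  intro i j hij
  rw [pow_two, Matrix.mul_apply]
  refine Finset.sum_eq_zero fun l _ => ?_
  by_cases h : l ≤ i
  · rw [hT i l h, zero_mul]
  · rw [hT l j (hij.trans (le_of_lt (not_le.mp h))), mul_zero]

lemma herm_re {d : ℕ} (T : Matrix (Fin d) (Fin d) ℂ) : (T + Tᴴ).IsHermitian := by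
  unfold Matrix.IsHermitian; rw [conjTranspose_add, conjTranspose_conjTranspose, add_comm]

lemma herm_im {d : ℕ} (T : Matrix (Fin d) (Fin d) ℂ) : (Complex.I • (T - Tᴴ)).IsHermitian := by
  unfold Matrix.IsHermitian
  rw [conjTranspose_smul, conjTranspose_sub, conjTranspose_conjTranspose, Complex.star_def,
    Complex.conj_I, neg_smul, ← smul_neg, neg_sub]

lemma real_aux {h y α β : ℝ} (hh : 0 ≤ h) (hy : 0 ≤ y)
    (H : h ≤ α * y + β * (Real.sqrt h * Real.sqrt y)) : h ≤ (2 * α + β ^ 2) * y := by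
  have e1 := Real.sq_sqrt hh
  have e2 := Real.sq_sqrt hy
  nlinarith [sq_nonneg (Real.sqrt h - β * Real.sqrt y)]

lemma trunc (k : ℕ) : ∃ C : ℝ, 0 ≤ C ∧ ∀ (d : ℕ) (T : Matrix (Fin d) (Fin d) ℂ), StrictUpper T →
    tau (k+1) (T + Tᴴ) ≤ C * tau (k+1) (Complex.I • (T - Tᴴ)) := by
  induction k with
  | zero =>
    refine ⟨1, zero_le_one, fun d T hT => ?_⟩
    have t2 : trace (T * T) = 0 := by
      rw [← pow_two, trace]
      exact Finset.sum_eq_zero fun i _ => hT.sq i i le_rfl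
    have t3 : trace (Tᴴ * Tᴴ) = 0 := by
      rw [← conjTranspose_mul, trace_conjTranspose, t2, star_zero]
    unfold tau
    apply le_of_eq
    rw [one_mul]
    congr 1
    rw [zero_add, pow_one, smul_pow, Complex.I_sq, trace_smul, pow_two, pow_two]
    simp only [add_mul, mul_add, sub_mul, mul_sub, trace_add, trace_sub, t2, t3]
    simp [add_comm]
  | succ k ih =>
    obtain ⟨C, hC, ih⟩ := ih
    set c : ℝ := 2 ^ (2 ^ (k+1)) with hc
    have hc0 : 0 < c := by positivity
    refine ⟨2 * c + (c * (c * (C * ((1/2) ^ (2 ^ (k+1)) * 4 ^ (2 ^ k))))) ^ 2, by positivity,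
      fun d T hT => ?_⟩
    set H := T + Tᴴ with hH
    set Y := Complex.I • (T - Tᴴ) with hY
    have hHh : H.IsHermitian := herm_re T
    have hYh : Y.IsHermitian := herm_im T
    have e1 : H ^ 2 = Y ^ 2 + ((2 : ℝ) : ℂ) • (T ^ 2 + (T ^ 2)ᴴ) := by
      rw [hH, hY, smul_pow, Complex.I_sq, conjTranspose_pow]
      simp only [pow_two, add_mul, mul_add, sub_mul, mul_sub, neg_smul, one_smul, smul_add,
        Complex.ofReal_ofNat, two_smul]
      abel
    have e2 : Complex.I • (T ^ 2 - (T ^ 2)ᴴ) = ((1/2 : ℝ) : ℂ) • (H * Y + Y * H) := by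
      rw [hH, hY, conjTranspose_pow]
      have : (T + Tᴴ) * (Complex.I • (T - Tᴴ)) + Complex.I • (T - Tᴴ) * (T + Tᴴ)
          = (2 : ℂ) • Complex.I • (T ^ 2 - Tᴴ ^ 2) := by
        rw [Matrix.mul_smul, Matrix.smul_mul, ← smul_add, smul_comm]
        congr 1
        simp only [pow_two, add_mul, mul_add, sub_mul, mul_sub, two_smul]
        abel
      rw [this, smul_smul]
      norm_num
    apply real_aux (tau_nonneg _ hHh) (tau_nonneg _ hYh)
    calc tau (k+1+1) H = tau (k+1) (H ^ 2) := (tau_sq _ _).symm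
      _ ≤ c * (tau (k+1) (Y ^ 2) + tau (k+1) (((2 : ℝ) : ℂ) • (T ^ 2 + (T ^ 2)ᴴ))) := by
        rw [e1]
        refine tau_add k (hYh.pow 2) ?_
        have := herm_re (T ^ 2)
        unfold Matrix.IsHermitian at *
        rw [conjTranspose_smul, this, Complex.star_def, Complex.conj_ofReal]
      _ ≤ c * (tau (k+1+1) Y + c * (C * ((1/2) ^ (2 ^ (k+1)) * (4 ^ (2 ^ k) *
            (Real.sqrt (tau (k+1+1) H) * Real.sqrt (tau (k+1+1) Y)))))) := by
        rw [tau_sq, tau_smul]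
        gcongr
        refine (ih d _ hT.sq).trans ?_
        rw [e2, tau_smul]
        gcongr
        exact tau_mul k hHh hYh
      _ = _ := by ring

end Trunc

section Schur
open Module

lemma schur_basis (d : ℕ) : ∀ (V : Type*) [NormedAddCommGroup V] [InnerProductSpace ℂ V]
    [FiniteDimensional ℂ V], finrank ℂ V = d → ∀ T : V →ₗ[ℂ] V,
    ∃ b : OrthonormalBasis (Fin d) ℂ V, ∀ i j, j < i → inner ℂ (b i) (T (b j)) = 0 := by
  induction d with
  | zero =>
    intro V _ _ _ hd T
    exact ⟨(stdOrthonormalBasis ℂ V).reindex (finCongr hd), fun i => i.elim0⟩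
  | succ d ih =>
    intro V _ _ _ hd T
    have : Fact (finrank ℂ V = d + 1) := ⟨hd⟩
    have : Nontrivial V := Module.nontrivial_of_finrank_pos (R := ℂ) (by omega)
    obtain ⟨μ, hμ⟩ := Module.End.exists_eigenvalue (LinearMap.adjoint T)
    obtain ⟨v0, hv0⟩ := hμ.exists_hasEigenvector
    have hv0n : v0 ≠ 0 := hv0.2
    set v : V := ((‖v0‖⁻¹ : ℝ) : ℂ) • v0 with hv
    have hvn : ‖v‖ = 1 := by
      rw [hv, norm_smul, Complex.norm_real, norm_inv, norm_norm,
        inv_mul_cancel₀ (norm_ne_zero_iff.2 hv0n)]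
    have hv1 : v ≠ 0 := by intro h; rw [h, norm_zero] at hvn; exact zero_ne_one hvn
    have hTv : LinearMap.adjoint T v = μ • v := by
      rw [hv, map_smul, hv0.apply_eq_smul, smul_comm]
    set W : Submodule ℂ V := (ℂ ∙ v)ᗮ with hW
    have hWd : finrank ℂ W = d := Submodule.finrank_orthogonal_span_singleton hv1
    have hmem : ∀ x : V, x ∈ W ↔ inner ℂ v x = 0 := fun x =>
      Submodule.mem_orthogonal_singleton_iff_inner_right
    have hinv : ∀ x ∈ W, T x ∈ W := by
      intro x hx
      rw [hmem] at hx ⊢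
      rw [← LinearMap.adjoint_inner_left, hTv, inner_smul_left, hx, mul_zero]
    obtain ⟨b', hb'⟩ := ih W hWd (T.restrict hinv)
    let e : Fin (d+1) → V := Fin.snoc (fun i => (b' i : V)) v
    have he1 : ∀ i : Fin d, e i.castSucc = b' i := fun i => by simp [e]
    have he2 : e (Fin.last d) = v := by simp [e]
    have hvb : ∀ i, inner ℂ v (b' i : V) = 0 := fun i => (hmem _).1 (b' i).2
    have hon : Orthonormal ℂ e := by
      rw [orthonormal_iff_ite]
      intro i j
      refine Fin.lastCases ?_ (fun i => ?_) i <;> refine Fin.lastCases ?_ (fun j => ?_) j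
      · rw [he2, inner_self_eq_norm_sq_to_K, hvn]; simp
      · rw [he1, he2, hvb, if_neg (Fin.castSucc_lt_last j).ne']
      · rw [he1, he2, ← inner_conj_symm, hvb, map_zero, if_neg (Fin.castSucc_lt_last i).ne]
      · rw [he1, he1, ← Submodule.coe_inner, orthonormal_iff_ite.1 b'.orthonormal i j]
        simp
    have hcard : finrank ℂ V = Fintype.card (Fin (d+1)) := by simpa using hd
    obtain ⟨b, hb⟩ := Orthonormal.exists_orthonormalBasis_extension_of_card_eq (𝕜 := ℂ)
      hcard (v := e) (s := Set.univ)
      (by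
        rw [orthonormal_iff_ite] at hon ⊢
        rintro ⟨i, _⟩ ⟨j, _⟩
        simpa using hon i j)
    refine ⟨b, fun i j => ?_⟩
    rw [hb i (Set.mem_univ _), hb j (Set.mem_univ _)]
    refine Fin.lastCases ?_ (fun i => ?_) i <;> refine Fin.lastCases ?_ (fun j => ?_) j
    · intro h; exact absurd h (lt_irrefl _)
    · intro _
      rw [he1, he2]
      exact (hmem _).1 (hinv _ (b' j).2)
    · intro h; exact absurd h (not_lt.2 (Fin.le_last _))
    · intro h
      rw [he1, he1]
      exact hb' i j (by simpa using h)

lemma schur_eig {d : ℕ} {V : Type*} [NormedAddCommGroup V] [InnerProductSpace ℂ V]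
    [FiniteDimensional ℂ V] (T : V →ₗ[ℂ] V) (b : OrthonormalBasis (Fin d) ℂ V)
    (hb : ∀ i j, j < i → inner ℂ (b i) (T (b j)) = 0) (i : Fin d) :
    Module.End.HasEigenvalue T (inner ℂ (b i) (T (b i))) := by
  have hM : ∀ i j, LinearMap.toMatrix b.toBasis b.toBasis T i j = inner ℂ (b i) (T (b j)) := by
    intro i j
    rw [LinearMap.toMatrix_apply]
    simp [OrthonormalBasis.repr_apply_apply]
  rw [Module.End.hasEigenvalue_iff_isRoot_charpoly, ← LinearMap.charpoly_toMatrix T b.toBasis,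
    Matrix.charpoly_of_isUpperTriangular]
  · rw [Polynomial.IsRoot, Polynomial.eval_prod]
    refine Finset.prod_eq_zero (Finset.mem_univ i) ?_
    rw [hM]; simp
  · intro i j hij
    rw [hM]; exact hb i j hij

end Schur

section KBound
open Matrix
variable {H : Type*} [NormedAddCommGroup H] [InnerProductSpace ℂ H]

lemma sNum_nonneg (T : H →L[ℂ] H) (n : ℕ) : 0 ≤ sNum T n :=
  Real.iInf_nonneg fun _ => norm_nonneg _

lemma sNum_le (T F : H →L[ℂ] H) (n : ℕ)
    (hF : Module.rank ℂ (LinearMap.range (F : H →ₗ[ℂ] H)) < (n : Cardinal)) :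
    sNum T n ≤ ‖T - F‖ :=
  ciInf_le (f := fun F : {F : H →L[ℂ] H //
    Module.rank ℂ (LinearMap.range (F : H →ₗ[ℂ] H)) < (n : Cardinal)} => ‖T - (F : H →L[ℂ] H)‖)
    ⟨0, by rintro _ ⟨F, rfl⟩; exact norm_nonneg _⟩ ⟨F, hF⟩

lemma le_sNum (T : H →L[ℂ] H) (n : ℕ) (c : ℝ)
    (h : ∀ F : H →L[ℂ] H, Module.rank ℂ (LinearMap.range (F : H →ₗ[ℂ] H)) < ((n+1 : ℕ) : Cardinal) →
      c ≤ ‖T - F‖) : c ≤ sNum T (n+1) := by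
  have : Nonempty {F : H →L[ℂ] H //
    Module.rank ℂ (LinearMap.range (F : H →ₗ[ℂ] H)) < ((n+1 : ℕ) : Cardinal)} := by
    refine ⟨⟨0, ?_⟩⟩
    have : LinearMap.range ((0 : H →L[ℂ] H) : H →ₗ[ℂ] H) = ⊥ := by
      rw [ContinuousLinearMap.toLinearMap_zero, LinearMap.range_zero]
    rw [this, rank_bot]
    exact_mod_cast Nat.succ_pos n
  exact le_ciInf fun F => h F.1 F.2

lemma sNum_smul_le (T : H →L[ℂ] H) (c : ℂ) (hc : ‖c‖ = 1) (n : ℕ) :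
    sNum (c • T) (n+1) ≤ sNum T (n+1) := by
  refine le_sNum _ _ _ fun F hF => ?_
  refine (sNum_le _ (c • F) _ ?_).trans ?_
  · refine lt_of_le_of_lt (Submodule.rank_mono ?_) hF
    rintro _ ⟨x, rfl⟩
    exact ⟨c • x, by simp⟩
  · rw [← smul_sub, norm_smul, hc, one_mul]

lemma eig_le_sNum {d N : ℕ} (J : EuclideanSpace ℂ (Fin d) →L[ℂ] H) (hJ : ∀ x, ‖J x‖ = ‖x‖)
    (K : H →L[ℂ] H) (X : EuclideanSpace ℂ (Fin d) →L[ℂ] EuclideanSpace ℂ (Fin d))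
    (hX : ∀ w, (inner ℂ w (X w)).re = (inner ℂ (J w) (K (J w))).re)
    (u : Fin N → EuclideanSpace ℂ (Fin d)) (hu : Orthonormal ℂ u) (y : Fin N → ℝ)
    (hy : Antitone y) (hXu : ∀ i, X (u i) = (y i : ℂ) • u i) (j : Fin N) :
    y j ≤ sNum K (j + 1) := by
  refine le_sNum _ _ _ fun F hF => ?_
  -- linear map from coefficient space
  have hj : (j : ℕ) + 1 ≤ N := j.2
  let ι : Fin (j+1) → Fin N := Fin.castLE hj
  have hι : Function.Injective ι := Fin.castLE_injective hj
  have huι : Orthonormal ℂ (u ∘ ι) := hu.comp ι hι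
  let G : (Fin (j+1) → ℂ) →ₗ[ℂ] EuclideanSpace ℂ (Fin d) := Fintype.linearCombination ℂ (u ∘ ι)
  have hG : ∀ c, G c = ∑ i, c i • u (ι i) := fun c => rfl
  let Φ : (Fin (j+1) → ℂ) →ₗ[ℂ] LinearMap.range (F : H →ₗ[ℂ] H) :=
    (F : H →ₗ[ℂ] H).rangeRestrict ∘ₗ (J : EuclideanSpace ℂ (Fin d) →ₗ[ℂ] H) ∘ₗ G
  have hni : ¬ Function.Injective Φ := by
    intro hinj
    have h1 := LinearMap.lift_rank_le_of_injective Φ hinj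
    rw [rank_fin_fun] at h1
    have h2 : Cardinal.lift.{0} (Module.rank ℂ (LinearMap.range (F : H →ₗ[ℂ] H))) <
        ((j + 1 : ℕ) : Cardinal) := by simpa using hF
    simp at h1
    exact absurd hF (not_lt.2 (by simpa using h1))
  obtain ⟨c, hc, hc0⟩ : ∃ c, Φ c = 0 ∧ c ≠ 0 := by
    by_contra hcon
    push Not at hcon
    exact hni ((injective_iff_map_eq_zero Φ).2 hcon)
  set w := G c with hw
  have hFw : F (J w) = 0 := congrArg Subtype.val hc
  have hnorm : (‖w‖ ^ 2 : ℝ) = ∑ i, ‖c i‖ ^ 2 := by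
    have : inner ℂ w w = ∑ i, (starRingEnd ℂ) (c i) * c i := by
      rw [hw, hG]; exact huι.inner_sum c c Finset.univ
    have h2 := congrArg Complex.re this
    have h3 : (inner ℂ w w).re = ‖w‖ ^ 2 := inner_self_eq_norm_sq (𝕜 := ℂ) w
    rw [Complex.re_sum, h3] at h2
    rw [h2]
    refine Finset.sum_congr rfl fun i _ => ?_
    rw [mul_comm, Complex.mul_conj, Complex.ofReal_re, Complex.normSq_eq_norm_sq]
  have hwpos : 0 < ‖w‖ ^ 2 := by
    rw [hnorm]
    obtain ⟨i, hi⟩ := Function.ne_iff.1 hc0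
    exact Finset.sum_pos' (fun _ _ => sq_nonneg _) ⟨i, Finset.mem_univ _, by
      have : 0 < ‖c i‖ := norm_pos_iff.2 hi
      positivity⟩
  have hXw : X w = ∑ i, (c i * (y (ι i) : ℂ)) • u (ι i) := by
    rw [hw, hG, map_sum]
    refine Finset.sum_congr rfl fun i _ => ?_
    rw [map_smul, hXu, smul_smul]
  have hin : (inner ℂ w (X w)).re = ∑ i, y (ι i) * ‖c i‖ ^ 2 := by
    have : inner ℂ w (X w) = ∑ i, (starRingEnd ℂ) (c i) * (c i * (y (ι i) : ℂ)) := by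
      rw [hXw, hw, hG]; exact huι.inner_sum c (fun i => c i * (y (ι i) : ℂ)) Finset.univ
    rw [this, Complex.re_sum]
    refine Finset.sum_congr rfl fun i _ => ?_
    rw [← mul_assoc, mul_comm ((starRingEnd ℂ) (c i)), Complex.mul_conj, ← Complex.ofReal_mul,
      Complex.ofReal_re, Complex.normSq_eq_norm_sq, mul_comm]
  have hlow : y j * ‖w‖ ^ 2 ≤ (inner ℂ w (X w)).re := by
    rw [hin, hnorm, Finset.mul_sum]
    refine Finset.sum_le_sum fun i _ => mul_le_mul_of_nonneg_right (hy ?_) (sq_nonneg _)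
    rw [Fin.le_def]
    exact Nat.lt_succ_iff.1 i.2
  have hup : (inner ℂ w (X w)).re ≤ ‖K - F‖ * ‖w‖ ^ 2 := by
    rw [hX]
    have : K (J w) = (K - F) (J w) := by
      rw [_root_.sub_apply, hFw, sub_zero]
    rw [this]
    calc _ ≤ ‖inner ℂ (J w) ((K - F) (J w))‖ := Complex.re_le_norm _
      _ ≤ ‖J w‖ * ‖(K - F) (J w)‖ := norm_inner_le_norm _ _
      _ ≤ ‖J w‖ * (‖K - F‖ * ‖J w‖) := by gcongr; exact (K - F).le_opNorm _
      _ = _ := by rw [hJ]; ring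
  exact le_of_mul_le_mul_right (hlow.trans hup) hwpos

end KBound

section KBound2
open Matrix
variable {H : Type*} [NormedAddCommGroup H] [InnerProductSpace ℂ H]

lemma even_two_pow_succ (k : ℕ) : Even (2 ^ (k+1)) := (Nat.even_pow' (by omega)).2 even_two

lemma tau_K {d : ℕ} (k : ℕ) (J : EuclideanSpace ℂ (Fin d) →L[ℂ] H) (hJ : ∀ x, ‖J x‖ = ‖x‖)
    (K : H →L[ℂ] H) (X : Matrix (Fin d) (Fin d) ℂ) (hXh : X.IsHermitian)
    (hX : ∀ w, (inner ℂ w (toEuclideanCLM (n := Fin d) (𝕜 := ℂ) X w)).re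
      = (inner ℂ (J w) (K (J w))).re)
    (s : ℕ → ℝ) (hs : ∀ n, sNum K (n+1) ≤ s n) (hs' : ∀ n, sNum ((-1 : ℂ) • K) (n+1) ≤ s n)
    (hsum : Summable fun n => s n ^ (2 ^ (k+1))) :
    tau (k+1) X ≤ 2 * ∑' n, s n ^ (2 ^ (k+1)) := by
  have hs0 : ∀ n, 0 ≤ s n := fun n => (sNum_nonneg _ _).trans (hs n)
  set e : Fin (Fintype.card (Fin d)) ≃ Fin d := Fintype.equivOfCardEq (Fintype.card_fin _) with he
  set y := hXh.eigenvalues₀ with hy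
  have hya : Antitone y := hXh.eigenvalues₀_antitone
  have hye : ∀ j, hXh.eigenvalues (e j) = y j := by
    intro j
    simp [Matrix.IsHermitian.eigenvalues, he, hy]
  set u : Fin (Fintype.card (Fin d)) → EuclideanSpace ℂ (Fin d) :=
    fun j => hXh.eigenvectorBasis (e j) with hu
  have huo : Orthonormal ℂ u := hXh.eigenvectorBasis.orthonormal.comp e e.injective
  have hXu : ∀ j, toEuclideanCLM (n := Fin d) (𝕜 := ℂ) X (u j) = (y j : ℂ) • u j := by
    intro j
    have := hXh.mulVec_eigenvectorBasis (e j)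
    rw [hye] at this
    apply (WithLp.ofLp_injective 2)
    rw [ofLp_toEuclideanCLM, this]
    ext i
    simp [hu]
  have h1 : ∀ j, y j ≤ s j := fun j =>
    (eig_le_sNum J hJ K _ hX u huo y hya hXu j).trans (hs j)
  have h2 : ∀ j, - y (Fin.rev j) ≤ s j := by
    intro j
    refine (eig_le_sNum J hJ ((-1 : ℂ) • K) (-(toEuclideanCLM (n := Fin d) (𝕜 := ℂ) X))
      ?_ (u ∘ Fin.rev) (huo.comp _ Fin.rev_injective) (fun j => - y (Fin.rev j)) ?_ ?_ j).trans
      (hs' j)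
    · intro w
      have := hX w
      simp [this]
    · intro a b hab
      exact neg_le_neg (hya (Fin.rev_le_rev.2 hab))
    · intro i
      simp [hXu]
  rw [tau_eig _ hXh, ← e.sum_comp]
  simp only [hye]
  have h3 : ∀ j, y j ^ (2 ^ (k+1)) ≤ s j ^ (2 ^ (k+1)) + s (Fin.rev j) ^ (2 ^ (k+1)) := by
    intro j
    by_cases hj : 0 ≤ y j
    · have := pow_le_pow_left₀ hj (h1 j) (2 ^ (k+1))
      have := pow_nonneg (hs0 (Fin.rev j)) (2 ^ (k+1))
      linarith
    · have h4 := h2 (Fin.rev j)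
      rw [Fin.rev_rev] at h4
      have := pow_le_pow_left₀ (by linarith) h4 (2 ^ (k+1))
      rw [(even_two_pow_succ k).neg_pow] at this
      have := pow_nonneg (hs0 j) (2 ^ (k+1))
      linarith
  have h5 : ∑ j : Fin (Fintype.card (Fin d)), s j ^ (2 ^ (k+1)) ≤ ∑' n, s n ^ (2 ^ (k+1)) := by
    rw [Fin.sum_univ_eq_sum_range (fun n => s n ^ (2 ^ (k+1)))]
    exact hsum.sum_le_tsum _ fun n _ => pow_nonneg (hs0 n) _
  calc _ ≤ ∑ j : Fin (Fintype.card (Fin d)),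
        (s j ^ (2 ^ (k+1)) + s (Fin.rev j) ^ (2 ^ (k+1))) := Finset.sum_le_sum fun j _ => h3 j
    _ = ∑ j : Fin (Fintype.card (Fin d)), s j ^ (2 ^ (k+1))
        + ∑ j : Fin (Fintype.card (Fin d)), s j ^ (2 ^ (k+1)) := by
        rw [Finset.sum_add_distrib]
        congr 1
        exact Equiv.sum_comp Fin.revPerm (fun j : Fin (Fintype.card (Fin d)) => s j ^ (2 ^ (k+1)))
    _ ≤ _ := by linarith

end KBound2

section FinRank
open Matrix
open scoped Matrix.Norms.L2Operator

lemma finrank_approx {d : ℕ} (k n : ℕ) (S : Matrix (Fin d) (Fin d) ℂ) (hS : S.IsHermitian)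
    (M t : ℝ) (ht : 0 < t) (hM : tau (k+1) S ≤ M) (hn : M < n * t ^ (2 ^ (k+1))) :
    ∃ F : Matrix (Fin d) (Fin d) ℂ, F.rank < n ∧
      ‖toEuclideanCLM (n := Fin d) (𝕜 := ℂ) (S - F)‖ ≤ t := by
  obtain ⟨U, hU, h⟩ := exists_diag hS
  set y := hS.eigenvalues with hy
  have hU' : star U * U = 1 := mul_eq_one_comm.mp hU
  have hSU : S = U * diagonal (fun i => (y i : ℂ)) * star U := by
    rw [← h]
    calc S = (U * star U) * S * (U * star U) := by rw [hU, one_mul, mul_one]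
      _ = _ := by simp only [mul_assoc]
  let z : Fin d → ℂ := fun i => if t < |y i| then (y i : ℂ) else 0
  refine ⟨U * diagonal z * star U, ?_, ?_⟩
  · have h1 : (U * diagonal z * star U).rank ≤ (diagonal z).rank :=
      (rank_mul_le_left _ _).trans (rank_mul_le_right _ _)
    refine lt_of_le_of_lt h1 ?_
    rw [rank_diagonal, Fintype.card_subtype]
    have h2 : ((Finset.univ.filter fun i => z i ≠ 0).card : ℝ) * t ^ (2 ^ (k+1)) ≤ M := by
      refine le_trans ?_ hM
      rw [tau_eig _ hS, ← nsmul_eq_mul, ← Finset.sum_const]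
      refine (Finset.sum_le_sum fun i hi => ?_).trans
        (Finset.sum_le_sum_of_subset_of_nonneg (Finset.filter_subset _ _) fun i _ _ =>
          (even_two_pow_succ k).pow_nonneg _)
      have hzi : z i ≠ 0 := (Finset.mem_filter.1 hi).2
      have : t < |y i| := by
        by_contra hc
        exact hzi (if_neg hc)
      rw [← (even_two_pow_succ k).pow_abs (hS.eigenvalues i)]
      exact pow_le_pow_left₀ ht.le this.le _
    have h3 := h2.trans_lt hn
    have h4 := lt_of_mul_lt_mul_right h3 (by positivity)
    exact_mod_cast h4
  · rw [l2_opNorm_toEuclideanCLM, hSU, ← sub_mul, ← mul_sub, diagonal_sub]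
    have hUu : U ∈ unitary (Matrix (Fin d) (Fin d) ℂ) := ⟨hU', hU⟩
    have hUs : star U ∈ unitary (Matrix (Fin d) (Fin d) ℂ) := ⟨by rwa [star_star], by rwa [star_star]⟩
    rw [CStarRing.norm_mul_mem_unitary _ hUs, CStarRing.norm_mem_unitary_mul _ hUu,
      l2_opNorm_diagonal, pi_norm_le_iff_of_nonneg ht.le]
    intro i
    by_cases hi : t < |y i|
    · simp [z, hi, ht.le]
    · simp [z, hi]
      exact not_lt.1 hi

lemma norm_diag_le {d : ℕ} (E : Fin d → ℝ) (ε : ℝ) (hε : 0 ≤ ε) (hE : ∀ i, |E i| ≤ ε) :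
    ‖toEuclideanCLM (n := Fin d) (𝕜 := ℂ) (diagonal fun i => (E i : ℂ))‖ ≤ ε := by
  rw [l2_opNorm_toEuclideanCLM, l2_opNorm_diagonal, pi_norm_le_iff_of_nonneg hε]
  intro i
  simpa using hE i

end FinRank

section Mat
open Matrix

lemma mat_core (k : ℕ) : ∃ C : ℝ, 0 ≤ C ∧ ∀ (d : ℕ) (MB MK : Matrix (Fin d) (Fin d) ℂ) (ε M : ℝ),
    MB.IsHermitian → (∀ i j, j < i → (MB + MK) i j = 0) → (∀ i, ‖(MB + MK) i i‖ ≤ ε) →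
    tau (k+1) (((1/2 : ℝ) : ℂ) • (MK + MKᴴ)) ≤ M →
    tau (k+1) (((1/2 : ℝ) : ℂ) • (Complex.I • (MK - MKᴴ))) ≤ M →
    ∃ (S : Matrix (Fin d) (Fin d) ℂ) (E : Fin d → ℝ), S.IsHermitian ∧
      MB = diagonal (fun i => (E i : ℂ)) + S ∧ (∀ i, |E i| ≤ ε) ∧ tau (k+1) S ≤ C * M := by
  obtain ⟨C, hC, htr⟩ := trunc k
  set p := 2 ^ (k+1) with hp
  have hpe : Even p := even_two_pow_succ k
  refine ⟨2 ^ p * ((1/2) ^ p * (C * (2 ^ p * (2 ^ p * (1 + 1)))) + 1), by positivity, ?_⟩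
  intro d MB MK ε M hB htri hdiag hR hI
  set MA := MB + MK with hMA
  set D : Matrix (Fin d) (Fin d) ℂ := diagonal fun i => MA i i with hD
  set T := MA - D with hT
  have hTs : StrictUpper T := by
    intro i j hij
    rcases hij.lt_or_eq with h | h
    · rw [hT, Matrix.sub_apply, htri i j h, hD, diagonal_apply_ne _ h.ne', sub_zero]
    · subst h; rw [hT, Matrix.sub_apply, hD, diagonal_apply_eq, sub_self]
  have hsm : ∀ (c : ℝ) {S : Matrix (Fin d) (Fin d) ℂ}, S.IsHermitian →
      ((c : ℂ) • S).IsHermitian := by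
    intro c S hS
    unfold Matrix.IsHermitian
    rw [conjTranspose_smul, hS.eq, Complex.star_def, Complex.conj_ofReal]
  set X := ((1/2 : ℝ) : ℂ) • (Complex.I • (MK - MKᴴ)) with hX
  have hXh : X.IsHermitian := hsm _ (herm_im MK)
  have hXA : X = ((1/2 : ℝ) : ℂ) • (Complex.I • (MA - MAᴴ)) := by
    rw [hX, hMA, conjTranspose_add, hB.eq]
    congr 2
    abel
  have hXd : ∀ i, ((X i i).re : ℂ) = (1/2) * (Complex.I * (MA i i - star (MA i i))) := by
    intro i
    have h1 : X i i = (1/2) * (Complex.I * (MA i i - star (MA i i))) := by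
      rw [hXA]; simp
    have h2 : star (X i i) = X i i := hXh.apply i i
    rw [← h1]
    exact Complex.conj_eq_iff_re.1 h2
  set D' : Matrix (Fin d) (Fin d) ℂ := diagonal fun i => ((X i i).re : ℂ) with hD'
  have hD'h : D'.IsHermitian := by
    rw [hD', Matrix.isHermitian_diagonal_iff]
    intro i
    exact Complex.conj_ofReal _
  have hD't : tau (k+1) D' ≤ M := by
    rw [hD', tau_diagonal]
    exact (tau_diag (k+1) hXh).trans hI
  have hYT : Complex.I • (T - Tᴴ) = ((2 : ℝ) : ℂ) • (X + ((-1 : ℝ) : ℂ) • D') := by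
    have hDD : ((2 : ℝ) : ℂ) • D' = Complex.I • (D - Dᴴ) := by
      ext i j
      by_cases hij : i = j
      · subst hij
        simp only [hD', hD, Matrix.smul_apply, diagonal_apply_eq, Matrix.sub_apply,
          conjTranspose_apply, hXd, smul_eq_mul]
        push_cast; ring
      · have hji : ¬ j = i := fun h => hij h.symm
        simp [hD', hD, hij, hji, diagonal_apply]
    have hXX : ((2 : ℝ) : ℂ) • X = Complex.I • (MA - MAᴴ) := by
      rw [hXA, smul_smul]; norm_num
    rw [smul_add, hXX, smul_comm ((2 : ℝ) : ℂ) ((-1 : ℝ) : ℂ) D', hDD, hT, conjTranspose_sub, Complex.ofReal_neg,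
      Complex.ofReal_one, neg_smul, one_smul, ← sub_eq_add_neg, ← smul_sub]
    congr 1
    abel
  have hYb : tau (k+1) (Complex.I • (T - Tᴴ)) ≤ 2 ^ p * (2 ^ p * (M + M)) := by
    rw [hYT, tau_smul (k+1) 2]
    gcongr
    refine (tau_add k hXh (hsm _ hD'h)).trans ?_
    rw [tau_smul (k+1) (-1) D', ← hp, hpe.neg_one_pow, one_mul]
    gcongr
  have hHb := htr d T hTs
  set Q := ((1/2 : ℝ) : ℂ) • (MK + MKᴴ) with hQ
  have hQh : Q.IsHermitian := hsm _ (herm_re MK)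
  refine ⟨((1/2 : ℝ) : ℂ) • (T + Tᴴ) + ((-1 : ℝ) : ℂ) • Q, fun i => (MA i i).re,
    (hsm _ (herm_re T)).add (hsm _ hQh), ?_, fun i => (Complex.abs_re_le_norm _).trans (hdiag i), ?_⟩
  · have hDr : diagonal (fun i => ((MA i i).re : ℂ)) = ((1/2 : ℝ) : ℂ) • (D + Dᴴ) := by
      ext i j
      by_cases hij : i = j
      · subst hij
        simp only [hD, Matrix.smul_apply, diagonal_apply_eq, Matrix.add_apply,
          conjTranspose_apply, smul_eq_mul, Complex.re_eq_add_conj, Complex.star_def]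
        push_cast; ring
      · have hji : ¬ j = i := fun h => hij h.symm
        simp [hD, hij, hji, diagonal_apply]
    have hBB : MB = ((1/2 : ℝ) : ℂ) • (MB + MBᴴ) := by
      rw [hB.eq, ← two_smul ℂ MB, smul_smul]; norm_num
    rw [hDr, hQ, Complex.ofReal_neg, Complex.ofReal_one, neg_smul, one_smul, ← smul_neg,
      ← smul_add, ← smul_add]
    rw [hT, conjTranspose_sub, hMA, conjTranspose_add]
    conv_lhs => rw [hBB]
    congr 1
    abel
  · refine (tau_add k (hsm _ (herm_re T)) (hsm _ hQh)).trans ?_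
    rw [tau_smul (k+1) (1/2) (T + Tᴴ), tau_smul (k+1) (-1) Q, ← hp, hpe.neg_one_pow, one_mul, mul_assoc]
    gcongr
    calc (1/2) ^ p * tau (k+1) (T + Tᴴ) + tau (k+1) Q
        ≤ (1/2) ^ p * (C * (2 ^ p * (2 ^ p * (M + M)))) + M := by
          gcongr
          exact hHb.trans (by gcongr)
      _ = _ := by ring

end Mat

section Ops
variable {H : Type*} [NormedAddCommGroup H] [InnerProductSpace ℂ H] [CompleteSpace H]

lemma spec_small (A : H →L[ℂ] H) (hA : IsCompactOperator A)
    (hno : ∀ μ : ℂ, μ ≠ 0 → ¬ Module.End.HasEigenvalue (A : H →ₗ[ℂ] H) μ) (ε : ℝ) (hε : 0 < ε) :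
    ∃ δ : ℝ, 0 < δ ∧ ∀ A' : H →L[ℂ] H, ‖A' - A‖ ≤ δ → ∀ μ ∈ spectrum ℂ A', ‖μ‖ ≤ ε := by
  by_contra hcon
  push Not at hcon
  have hc : ∀ n : ℕ, ∃ A' : H →L[ℂ] H, ‖A' - A‖ ≤ 1 / ((n : ℝ) + 1) ∧
      ∃ μ ∈ spectrum ℂ A', ε < ‖μ‖ := fun n => hcon _ (by positivity)
  choose A' hA' μ hμ hμε using hc
  have h1 : ∀ n, μ n ∈ Metric.closedBall (0 : ℂ)
      ((‖A‖ + 1) * ‖(1 : H →L[ℂ] H)‖) := by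
    intro n
    rw [mem_closedBall_zero_iff]
    refine (spectrum.norm_le_norm_mul_of_mem (hμ n)).trans ?_
    gcongr
    have h2 : ‖A' n‖ ≤ ‖A‖ + ‖A' n - A‖ := by
      have := norm_add_le A (A' n - A)
      rwa [add_sub_cancel] at this
    have h3 : 1 / ((n : ℝ) + 1) ≤ 1 := by
      rw [div_le_one (by positivity)]
      linarith [Nat.cast_nonneg (α := ℝ) n]
    linarith [hA' n]
  obtain ⟨ν, -, φ, hφ, hlim⟩ := tendsto_subseq_of_bounded Metric.isBounded_closedBall h1
  have hAlim : Tendsto (fun n => A' (φ n)) atTop (𝓝 A) := by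
    have h4 : Tendsto A' atTop (𝓝 A) := by
      rw [tendsto_iff_norm_sub_tendsto_zero]
      exact squeeze_zero (fun _ => norm_nonneg _) hA' tendsto_one_div_add_atTop_nhds_zero_nat
    exact h4.comp hφ.tendsto_atTop
  have hνε : ε ≤ ‖ν‖ := ge_of_tendsto' hlim.norm fun n => (hμε (φ n)).le
  have hν0 : ν ≠ 0 := by
    rintro rfl
    rw [norm_zero] at hνε
    linarith
  have hl : Tendsto (fun n => algebraMap ℂ (H →L[ℂ] H) (μ (φ n)) - A' (φ n)) atTop
      (𝓝 (algebraMap ℂ (H →L[ℂ] H) ν - A)) :=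
    (((algebraMapCLM ℂ (H →L[ℂ] H)).continuous.tendsto ν).comp hlim).sub hAlim
  have hmem : algebraMap ℂ (H →L[ℂ] H) ν - A ∈ nonunits (H →L[ℂ] H) :=
    nonunits.isClosed.mem_of_tendsto hl (Eventually.of_forall fun n => hμ (φ n))
  exact hno ν hν0 ((hA.hasEigenvalue_iff_mem_spectrum hν0).2 hmem)

lemma proj_approx (A : H →L[ℂ] H) (hA : IsCompactOperator A) (ε : ℝ) (hε : 0 < ε) :
    ∃ V : Submodule ℂ H, FiniteDimensional ℂ V ∧ ∀ (W : Submodule ℂ H) [FiniteDimensional ℂ W],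
      V ≤ W → ‖A - W.starProjection ∘L A‖ ≤ ε := by
  have hc : IsCompact (closure ((A : H →ₗ[ℂ] H) '' Metric.closedBall 0 1)) :=
    IsCompactOperator.isCompact_closure_image_closedBall hA 1
  obtain ⟨t, htf, ht⟩ := Metric.totallyBounded_iff.1 hc.totallyBounded ε hε
  refine ⟨Submodule.span ℂ t, FiniteDimensional.span_of_finite ℂ htf, fun W _ hW => ?_⟩
  have key : ∀ x : H, ‖x‖ ≤ 1 → ‖(A - W.starProjection ∘L A) x‖ ≤ ε := by
    intro x hx
    have h1 : A x ∈ closure ((A : H →ₗ[ℂ] H) '' Metric.closedBall 0 1) :=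
      subset_closure ⟨x, by simpa using hx, rfl⟩
    obtain ⟨y, hy, hxy⟩ := Set.mem_iUnion₂.1 (ht h1)
    have hyW : y ∈ W := hW (Submodule.subset_span hy)
    have h2 : ‖A x - W.starProjection (A x)‖ ≤ ‖A x - y‖ := by
      rw [Submodule.starProjection_minimal]
      exact ciInf_le ⟨0, by rintro _ ⟨z, rfl⟩; exact norm_nonneg _⟩ (⟨y, hyW⟩ : W)
    rw [Metric.mem_ball, dist_eq_norm] at hxy
    exact h2.trans hxy.le
  refine ContinuousLinearMap.opNorm_le_of_unit_norm hε.le ?_ 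
  intro x hx
  exact key x hx.le

lemma compact_of_finrank (F : H →L[ℂ] H)
    [FiniteDimensional ℂ (LinearMap.range (F : H →ₗ[ℂ] H))] : IsCompactOperator F := by
  set V := LinearMap.range (F : H →ₗ[ℂ] H)
  have h1 : IsCompactOperator (id : V → V) := (isCompactOperator_id_iff_finiteDimensional (𝕜 := ℂ)).2 ‹_›
  have h2 := (h1.comp_clm (F.codRestrict V fun x => ⟨x, rfl⟩)).clm_comp V.subtypeL
  exact h2

lemma compact_of_sNum (K : H →L[ℂ] H) (h : Tendsto (fun n => sNum K (n+1)) atTop (𝓝 0)) :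
    IsCompactOperator K := by
  have hcl := isClosed_setOfPred_isCompactOperator (𝕜₁ := ℂ) (𝕜₂ := ℂ) (σ₁₂ := RingHom.id ℂ)
    (M₁ := H) (M₂ := H)
  have : K ∈ closure {f : H →L[ℂ] H | IsCompactOperator ⇑f} := by
    rw [Metric.mem_closure_iff]
    intro ε hε
    obtain ⟨n, hn⟩ := (h.eventually_lt_const hε).exists
    have : Nonempty {F : H →L[ℂ] H //
        Module.rank ℂ (LinearMap.range (F : H →ₗ[ℂ] H)) < ((n+1 : ℕ) : Cardinal)} :=
      ⟨⟨0, by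
        have : LinearMap.range ((0 : H →L[ℂ] H) : H →ₗ[ℂ] H) = ⊥ := by
          rw [ContinuousLinearMap.toLinearMap_zero]
          exact LinearMap.range_zero
        rw [this, rank_bot]
        exact_mod_cast Nat.succ_pos n⟩⟩
    obtain ⟨⟨F, hF⟩, hlt⟩ := exists_lt_of_ciInf_lt hn
    have : FiniteDimensional ℂ (LinearMap.range (F : H →ₗ[ℂ] H)) :=
      Module.rank_lt_aleph0_iff.1 (hF.trans (Cardinal.natCast_lt_aleph0))
    exact ⟨F, compact_of_finrank F, by rw [dist_eq_norm]; exact hlt⟩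
  rwa [hcl.closure_eq] at this

end Ops

section Slow

lemma slow_lower {b : ℝ} {L : ℝ → ℝ} (hb : 0 < b) (hpos : ∀ x, b ≤ x → 0 < L x)
    (hcd : ContDiffOn ℝ 1 L (Set.Ici b))
    (hslow : Tendsto (fun x : ℝ => x * deriv L x / L x) atTop (𝓝 0)) (δ : ℝ) (hδ : 0 < δ) :
    ∃ c : ℝ, 0 < c ∧ ∀ᶠ x : ℝ in atTop, c ≤ x ^ δ * L x := by
  obtain ⟨x₀, hx₀⟩ := eventually_atTop.1 (hslow.eventually_const_lt (neg_lt_zero.2 hδ))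
  set y := max x₀ (b + 1) with hy
  have hyb : b < y := by rw [hy]; exact lt_of_lt_of_le (by linarith) (le_max_right _ _)
  have hd : ∀ x, y ≤ x → HasDerivAt (fun x => x ^ δ * L x)
      (δ * x ^ (δ - 1) * L x + x ^ δ * deriv L x) x := by
    intro x hx
    have hxb : b < x := hyb.trans_le hx
    have h1 : DifferentiableAt ℝ L x :=
      (hcd.differentiableOn one_ne_zero).differentiableAt (Ici_mem_nhds hxb)
    exact (Real.hasDerivAt_rpow_const (Or.inl (hb.trans hxb).ne')).mul h1.hasDerivAt
  have hm : MonotoneOn (fun x => x ^ δ * L x) (Set.Ici y) := by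
    refine monotoneOn_of_deriv_nonneg (convex_Ici y)
      (fun x hx => (hd x hx).continuousAt.continuousWithinAt)
      (fun x hx => (hd x (interior_subset hx)).differentiableAt.differentiableWithinAt) ?_
    intro x hx
    have hx : y ≤ x := interior_subset hx
    rw [(hd x hx).deriv]
    have hxp : 0 < x := hb.trans (hyb.trans_le hx)
    have hLp : 0 < L x := hpos x (hyb.le.trans hx)
    have h2 := hx₀ x ((le_max_left _ _).trans hx)
    rw [lt_div_iff₀ hLp] at h2
    have h3 : x ^ δ = x ^ (δ - 1) * x := by
      rw [Real.rpow_sub_one hxp.ne']; field_simp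
    rw [h3]
    have h4 : 0 < x ^ (δ - 1) := Real.rpow_pos_of_pos hxp _
    nlinarith
  refine ⟨y ^ δ * L y, mul_pos (Real.rpow_pos_of_pos (hb.trans hyb) _) (hpos y hyb.le), ?_⟩
  filter_upwards [eventually_ge_atTop y] with x hx
  exact hm (Set.mem_Ici.2 le_rfl) hx hx

end Slow

section Main
open Matrix Module
variable {H : Type*} [NormedAddCommGroup H] [InnerProductSpace ℂ H] [CompleteSpace H]

noncomputable def cmpr {d : ℕ} (J : EuclideanSpace ℂ (Fin d) →L[ℂ] H) (A : H →L[ℂ] H) :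
    Matrix (Fin d) (Fin d) ℂ :=
  (toEuclideanCLM (n := Fin d) (𝕜 := ℂ)).symm ((ContinuousLinearMap.adjoint J) ∘L A ∘L J)

lemma cmpr_clm {d : ℕ} (J : EuclideanSpace ℂ (Fin d) →L[ℂ] H) (A : H →L[ℂ] H) :
    toEuclideanCLM (n := Fin d) (𝕜 := ℂ) (cmpr J A)
      = (ContinuousLinearMap.adjoint J) ∘L A ∘L J := by
  unfold cmpr
  exact (toEuclideanCLM (n := Fin d) (𝕜 := ℂ)).apply_symm_apply _

lemma cmpr_inner {d : ℕ} (J : EuclideanSpace ℂ (Fin d) →L[ℂ] H) (A : H →L[ℂ] H)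
    (v w : EuclideanSpace ℂ (Fin d)) :
    inner ℂ v (toEuclideanCLM (n := Fin d) (𝕜 := ℂ) (cmpr J A) w) = inner ℂ (J v) (A (J w)) := by
  rw [cmpr_clm, ContinuousLinearMap.comp_apply, ContinuousLinearMap.adjoint_inner_right,
    ContinuousLinearMap.comp_apply]

lemma cmpr_entry {d : ℕ} (J : EuclideanSpace ℂ (Fin d) →L[ℂ] H) (A : H →L[ℂ] H) (i j : Fin d) :
    cmpr J A i j = inner ℂ (J (EuclideanSpace.single i 1)) (A (J (EuclideanSpace.single j 1))) := by
  rw [← cmpr_inner, EuclideanSpace.inner_single_left, map_one, one_mul, ofLp_toEuclideanCLM]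
  simp

lemma cmpr_add {d : ℕ} (J : EuclideanSpace ℂ (Fin d) →L[ℂ] H) (A A' : H →L[ℂ] H) :
    cmpr J (A + A') = cmpr J A + cmpr J A' := by
  ext i j
  simp [cmpr_entry, inner_add_right]

lemma cmpr_adj {d : ℕ} (J : EuclideanSpace ℂ (Fin d) →L[ℂ] H) (A : H →L[ℂ] H) :
    (cmpr J A)ᴴ = cmpr J (ContinuousLinearMap.adjoint A) := by
  ext i j
  rw [conjTranspose_apply, cmpr_entry, cmpr_entry, ContinuousLinearMap.adjoint_inner_right,
    Complex.star_def, inner_conj_symm]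

lemma cmpr_re_inner {d : ℕ} (J : EuclideanSpace ℂ (Fin d) →L[ℂ] H) (K : H →L[ℂ] H)
    (w : EuclideanSpace ℂ (Fin d)) :
    (inner ℂ w (toEuclideanCLM (n := Fin d) (𝕜 := ℂ)
      (((1/2 : ℝ) : ℂ) • (cmpr J K + (cmpr J K)ᴴ)) w)).re = (inner ℂ (J w) (K (J w))).re := by
  rw [cmpr_adj, map_smul, map_add, _root_.smul_apply, _root_.add_apply,
    inner_smul_right, inner_add_right, cmpr_inner, cmpr_inner,
    ContinuousLinearMap.adjoint_inner_right, ← inner_conj_symm (K (J w)) (J w),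
    Complex.re_ofReal_mul, Complex.add_re, Complex.conj_re]
  ring

lemma cmpr_smul {d : ℕ} (J : EuclideanSpace ℂ (Fin d) →L[ℂ] H) (A : H →L[ℂ] H) (c : ℂ) :
    cmpr J (c • A) = c • cmpr J A := by
  ext i j
  simp [cmpr_entry, inner_smul_right]

lemma rank_lift {d : ℕ} (J : EuclideanSpace ℂ (Fin d) →L[ℂ] H) (F : Matrix (Fin d) (Fin d) ℂ)
    (n : ℕ) (hF : F.rank < n) :
    Module.rank ℂ (LinearMap.range ((J ∘L toEuclideanCLM (n := Fin d) (𝕜 := ℂ) F ∘L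
      ContinuousLinearMap.adjoint J : H →L[ℂ] H) : H →ₗ[ℂ] H)) < (n : Cardinal) := by
  set R := LinearMap.range (toEuclideanLin (𝕜 := ℂ) F) with hR
  have h1 : finrank ℂ R = F.rank := by
    rw [hR, toEuclideanLin_eq_toLin, ← rank_eq_finrank_range_toLin]
  have h2 : LinearMap.range ((J ∘L toEuclideanCLM (n := Fin d) (𝕜 := ℂ) F ∘L
      ContinuousLinearMap.adjoint J : H →L[ℂ] H) : H →ₗ[ℂ] H)
      ≤ R.map (J : EuclideanSpace ℂ (Fin d) →ₗ[ℂ] H) := by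
    rintro _ ⟨x, rfl⟩
    refine ⟨toEuclideanCLM (n := Fin d) (𝕜 := ℂ) F (ContinuousLinearMap.adjoint J x), ?_, rfl⟩
    rw [hR, ← coe_toEuclideanCLM_eq_toEuclideanLin]
    exact ⟨_, rfl⟩
  refine (Submodule.rank_mono h2).trans_lt ?_
  rw [← Module.finrank_eq_rank]
  have := Submodule.finrank_map_le (J : EuclideanSpace ℂ (Fin d) →ₗ[ℂ] H) R
  exact_mod_cast (this.trans_eq h1).trans_lt hF

lemma main_bound (B K : H →L[ℂ] H) (hBsa : IsSelfAdjoint B) (hBc : IsCompactOperator B)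
    (hKc : IsCompactOperator K)
    (hno : ∀ μ : ℂ, μ ≠ 0 → ¬ Module.End.HasEigenvalue ((B + K : H →L[ℂ] H) : H →ₗ[ℂ] H) μ) (k : ℕ)
    (hsum : Summable fun n => sNum K (n+1) ^ (2 ^ (k+1))) :
    ∃ C : ℝ, ∀ (n : ℕ) (t : ℝ), 0 < t → C < n * t ^ (2 ^ (k+1)) → sNum B n ≤ t := by
  obtain ⟨C, hC, hcore⟩ := mat_core k
  set M := 2 * ∑' n, sNum K (n+1) ^ (2 ^ (k+1)) with hM
  refine ⟨C * M, fun n t ht hn => le_of_forall_pos_le_add fun ε' hε' => ?_⟩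
  obtain ⟨ε, hε, rfl⟩ : ∃ ε : ℝ, 0 < ε ∧ ε' = 3 * ε := ⟨ε' / 3, by positivity, by ring⟩
  set A := B + K with hA
  have hAc : IsCompactOperator A := hBc.add hKc
  obtain ⟨δ, hδ, hspec⟩ := spec_small A hAc hno ε hε
  obtain ⟨V₁, hV₁, hap₁⟩ := proj_approx A hAc δ hδ
  obtain ⟨V₂, hV₂, hap₂⟩ := proj_approx B hBc ε hε
  set W := V₁ ⊔ V₂ with hW
  have hWA := hap₁ W le_sup_left
  have hWB := hap₂ W le_sup_right
  set P := W.starProjection with hP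
  set T : W →ₗ[ℂ] W := ((W.orthogonalProjectionOnto ∘L A ∘L W.subtypeL : W →L[ℂ] W) : W →ₗ[ℂ] W)
    with hT
  obtain ⟨b, hb⟩ := schur_basis (finrank ℂ W) W rfl T
  set J : EuclideanSpace ℂ (Fin (finrank ℂ W)) →L[ℂ] H :=
    W.subtypeL ∘L (b.repr.symm.toContinuousLinearEquiv :
      EuclideanSpace ℂ (Fin (finrank ℂ W)) →L[ℂ] W) with hJ
  have hJn : ∀ x, ‖J x‖ = ‖x‖ := fun x => b.repr.symm.norm_map x
  have hJe : ∀ i, J (EuclideanSpace.single i 1) = b i := by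
    intro i
    simp [hJ]
  have hJadj : ContinuousLinearMap.adjoint J = (b.repr.toContinuousLinearEquiv :
      W →L[ℂ] EuclideanSpace ℂ (Fin (finrank ℂ W))) ∘L W.orthogonalProjectionOnto := by
    rw [hJ, ContinuousLinearMap.adjoint_comp, Submodule.adjoint_subtypeL]
    congr 1
    exact LinearIsometryEquiv.adjoint_eq_symm b.repr.symm
  have hJJ : J ∘L ContinuousLinearMap.adjoint J = P := by
    rw [hJadj]
    ext x
    simp [hJ, hP]
  have hTin : ∀ i j, cmpr J A i j = inner ℂ (b i) (T (b j)) := by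
    intro i j
    rw [cmpr_entry, hJe, hJe, Submodule.coe_inner]
    have h1 : ((T (b j) : W) : H) = P (A (b j)) := rfl
    rw [h1, hP, ← Submodule.inner_starProjection_left_eq_right,
      Submodule.starProjection_eq_self_iff.2 (b i).2]
  have hcA : cmpr J B + cmpr J K = cmpr J A := (cmpr_add J B K).symm
  have hBadj : ContinuousLinearMap.adjoint B = B := hBsa.adjoint_eq
  have hPA : ‖P ∘L A - A‖ ≤ δ := by rw [norm_sub_rev]; exact hWA
  have hs1 : ∀ n, sNum ((-1 : ℂ) • K) (n+1) ≤ sNum K (n+1) := fun n =>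
    sNum_smul_le K (-1) (by simp) n
  obtain ⟨S, E, hSh, hBS, hE, hSt⟩ := hcore (finrank ℂ W) (cmpr J B) (cmpr J K) ε M
    (by
      unfold Matrix.IsHermitian
      rw [cmpr_adj, hBadj])
    (by
      intro i j hij
      rw [hcA, hTin, hb i j hij])
    (by
      intro i
      rw [hcA, hTin]
      set μ := inner ℂ (b i) (T (b i)) with hμ
      by_cases hμ0 : μ = 0
      · rw [hμ0, norm_zero]; exact hε.le
      refine hspec (P ∘L A) hPA μ ?_
      obtain ⟨w, hw⟩ := (schur_eig T b hb i).exists_hasEigenvector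
      have hw1 : T w = μ • w := hw.apply_eq_smul
      have hw2 : (P ∘L A) (w : H) = μ • (w : H) := by
        have := congrArg (Subtype.val) hw1
        exact this
      intro hu
      have hinj := (ContinuousLinearMap.isUnit_iff_bijective.1 hu).1
      have h0 : (algebraMap ℂ (H →L[ℂ] H) μ - P ∘L A) (w : H) = 0 := by
        rw [_root_.sub_apply, hw2, Algebra.algebraMap_eq_smul_one]
        simp
      have := hinj (h0.trans (map_zero _).symm)
      exact hw.2 (Subtype.ext this))
    (by
      exact tau_K k J hJn K _ (by
        have := herm_re (cmpr J K)
        unfold Matrix.IsHermitian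
        rw [conjTranspose_smul, this.eq, Complex.star_def, Complex.conj_ofReal])
        (cmpr_re_inner J K) (fun n => sNum K (n+1)) (fun n => le_rfl) hs1 hsum)
    (by
      have hI : Complex.I • (cmpr J K - (cmpr J K)ᴴ)
          = cmpr J (Complex.I • K) + (cmpr J (Complex.I • K))ᴴ := by
        rw [cmpr_smul, conjTranspose_smul, Complex.star_def, Complex.conj_I, smul_sub, neg_smul,
          sub_eq_add_neg]
      rw [hI]
      refine tau_K k J hJn (Complex.I • K) _ (by
        have := herm_re (cmpr J (Complex.I • K))
        unfold Matrix.IsHermitian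
        rw [conjTranspose_smul, this.eq, Complex.star_def, Complex.conj_ofReal])
        (cmpr_re_inner J (Complex.I • K)) (fun n => sNum K (n+1))
        (fun n => sNum_smul_le K _ (by simp) n) (fun n => ?_) hsum
      rw [smul_smul]
      exact sNum_smul_le K _ (by simp) n)
  obtain ⟨F, hFr, hFt⟩ := finrank_approx k n S hSh (C * M) t ht hSt hn
  set Φ := toEuclideanCLM (n := Fin (finrank ℂ W)) (𝕜 := ℂ) with hΦ
  refine (sNum_le B (J ∘L Φ F ∘L ContinuousLinearMap.adjoint J) n (rank_lift J F n hFr)).trans ?_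
  have hJ1 : ‖J‖ ≤ 1 := ContinuousLinearMap.opNorm_le_bound _ zero_le_one fun x => by
    rw [hJn, one_mul]
  have hJ2 : ‖ContinuousLinearMap.adjoint J‖ ≤ 1 := by
    rw [LinearIsometryEquiv.norm_map]; exact hJ1
  have hsand : ∀ X : EuclideanSpace ℂ (Fin (finrank ℂ W)) →L[ℂ] EuclideanSpace ℂ (Fin (finrank ℂ W)),
      ‖J ∘L X ∘L ContinuousLinearMap.adjoint J‖ ≤ ‖X‖ := by
    intro X
    calc _ ≤ ‖J‖ * ‖X ∘L ContinuousLinearMap.adjoint J‖ := ContinuousLinearMap.opNorm_comp_le _ _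
      _ ≤ ‖J‖ * (‖X‖ * ‖ContinuousLinearMap.adjoint J‖) := by
        gcongr; exact ContinuousLinearMap.opNorm_comp_le _ _
      _ ≤ 1 * (‖X‖ * 1) := by gcongr
      _ = ‖X‖ := by ring
  have hPn : ‖P‖ ≤ 1 := W.starProjection_norm_le
  have hPadj : ContinuousLinearMap.adjoint P = P :=
    (isSelfAdjoint_starProjection W).adjoint_eq
  have hBP : ‖B - B ∘L P‖ ≤ ε := by
    have h1 : B - B ∘L P = ContinuousLinearMap.adjoint (B - P ∘L B) := by
      rw [map_sub, ContinuousLinearMap.adjoint_comp, hPadj, hBadj]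
    rw [h1, LinearIsometryEquiv.norm_map]
    exact hWB
  have hPBP : J ∘L Φ (cmpr J B) ∘L ContinuousLinearMap.adjoint J = P ∘L B ∘L P := by
    rw [hΦ, cmpr_clm, ← hJJ]
    simp only [ContinuousLinearMap.comp_assoc]
  have hdec : B - J ∘L Φ F ∘L ContinuousLinearMap.adjoint J
      = (B - P ∘L B) + P ∘L (B - B ∘L P)
        + (J ∘L Φ (diagonal fun i => (E i : ℂ)) ∘L ContinuousLinearMap.adjoint J
          + J ∘L Φ (S - F) ∘L ContinuousLinearMap.adjoint J) := by
    have h1 : Φ (cmpr J B) = Φ (diagonal fun i => (E i : ℂ)) + Φ (S - F) + Φ F := by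
      rw [hBS, map_add, map_sub]; abel
    have h2 := hPBP
    rw [h1] at h2
    simp only [ContinuousLinearMap.comp_sub, ← h2, ContinuousLinearMap.add_comp,
      ContinuousLinearMap.comp_add]
    abel
  rw [hdec]
  have h3 : ‖P ∘L (B - B ∘L P)‖ ≤ ε := by
    calc _ ≤ ‖P‖ * ‖B - B ∘L P‖ := ContinuousLinearMap.opNorm_comp_le _ _
      _ ≤ 1 * ε := by gcongr
      _ = ε := one_mul _
  have h4 := (hsand (Φ (diagonal fun i => (E i : ℂ)))).trans (norm_diag_le E ε hε.le hE)
  have h5 := (hsand (Φ (S - F))).trans hFt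
  refine (norm_add_le_of_le (norm_add_le_of_le hWB h3) (norm_add_le_of_le h4 h5)).trans ?_
  linarith

end Main

section Final
variable {H : Type*} [NormedAddCommGroup H] [InnerProductSpace ℂ H] [CompleteSpace H]

lemma abstract_thm (B K : H →L[ℂ] H) (hBsa : IsSelfAdjoint B) (hBc : IsCompactOperator B)
    {b : ℝ} {L : ℝ → ℝ} (hb : 0 < b) (hpos : ∀ x, b ≤ x → 0 < L x)
    (hcd : ContDiffOn ℝ 1 L (Set.Ici b))
    (hslow : Tendsto (fun x : ℝ => x * deriv L x / L x) atTop (𝓝 0))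
    (a q : ℝ) (ha0 : 0 < a) (hq0 : 0 < q)
    (hBL : Tendsto (fun n : ℕ => sNum B n / L n) atTop (𝓝 a))
    (hKq : Summable (fun n : ℕ => sNum K (n + 1) ^ q)) :
    ∃ μ : ℂ, μ ≠ 0 ∧ Module.End.HasEigenvalue ((B + K : H →L[ℂ] H) : H →ₗ[ℂ] H) μ := by
  by_contra hcon
  push Not at hcon
  have hs0 : Tendsto (fun n => sNum K (n+1)) atTop (𝓝 0) := by
    have h1 := hKq.tendsto_atTop_zero.rpow_const (p := q⁻¹) (Or.inr (by positivity))
    rw [Real.zero_rpow (by positivity)] at h1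
    refine h1.congr fun n => ?_
    rw [← Real.rpow_mul (sNum_nonneg _ _), mul_inv_cancel₀ hq0.ne', Real.rpow_one]
  have hKc := compact_of_sNum K hs0
  obtain ⟨k, hk⟩ : ∃ k : ℕ, q ≤ ((2 ^ (k+1) : ℕ) : ℝ) := by
    obtain ⟨k, hk⟩ := exists_nat_ge q
    refine ⟨k, hk.trans ?_⟩
    exact_mod_cast (Nat.lt_two_pow_self (n := k)).le.trans
      (Nat.pow_le_pow_right (by norm_num) (Nat.le_succ k))
  have hsum : Summable fun n => sNum K (n+1) ^ (2 ^ (k+1)) := by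
    refine Summable.of_norm_bounded_eventually_nat hKq ?_
    filter_upwards [hs0.eventually_lt_const one_pos] with n hn
    have h0 := sNum_nonneg K (n+1)
    rw [Real.norm_of_nonneg (by positivity), ← Real.rpow_natCast]
    rcases h0.eq_or_lt with h | h
    · rw [← h, Real.zero_rpow hq0.ne', Real.zero_rpow (by positivity)]
    · exact Real.rpow_le_rpow_of_exponent_ge h hn.le hk
  obtain ⟨C, hC⟩ := main_bound B K hBsa hBc hKc hcon k hsum
  set p := 2 ^ (k+1) with hp
  have hp0 : (0 : ℝ) < (p : ℝ) := by rw [hp]; positivity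
  obtain ⟨c, hc, hcL⟩ := slow_lower hb hpos hcd hslow (1 / (2 * p)) (by positivity)
  have hcL' := tendsto_natCast_atTop_atTop (R := ℝ) |>.eventually hcL
  have hb' := tendsto_natCast_atTop_atTop (R := ℝ) |>.eventually (eventually_ge_atTop b)
  have ha' := hBL.eventually_const_lt (half_lt_self ha0)
  -- choose t = (a c / 2) n^{-δ} / 2
  set e := a / 2 * c / 2 with he
  have he0 : 0 < e := by positivity
  have hbig : ∀ᶠ n : ℕ in atTop, C / e ^ p < (n : ℝ) ^ (1 / 2 : ℝ) :=
    ((tendsto_rpow_atTop (by norm_num : (0 : ℝ) < 1 / 2)).comp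
      (tendsto_natCast_atTop_atTop (R := ℝ))).eventually_gt_atTop _
  obtain ⟨n, hn1, hn2, hn3, hn4, hn5⟩ :=
    (hcL'.and (hb'.and (ha'.and (hbig.and (eventually_ge_atTop 1))))).exists
  have hn0 : (0 : ℝ) < n := by exact_mod_cast hn5
  set r : ℝ := (n : ℝ) ^ (1 / (2 * (p : ℝ))) with hr
  have hr0 : 0 < r := Real.rpow_pos_of_pos hn0 _
  have hrp : r ^ p * (n : ℝ) ^ (1 / 2 : ℝ) = n := by
    rw [hr, ← Real.rpow_natCast, ← Real.rpow_mul hn0.le, ← Real.rpow_add hn0]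
    have : 1 / (2 * (p : ℝ)) * p + 1 / 2 = 1 := by field_simp; norm_num
    rw [this, Real.rpow_one]
  have hLn := hpos _ hn2
  have h1 : sNum B n ≤ e / r := by
    refine hC n (e / r) (by positivity) ?_
    rw [div_lt_iff₀ (by positivity)] at hn4
    rw [div_pow, ← hrp]
    have : r ^ p * (n : ℝ) ^ (1 / 2 : ℝ) * (e ^ p / r ^ p) = (n : ℝ) ^ (1 / 2 : ℝ) * e ^ p := by
      field_simp
    rw [this]
    exact hn4
  rw [lt_div_iff₀ hLn] at hn3
  rw [le_div_iff₀ hr0] at h1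
  have h2 : a / 2 * c ≤ a / 2 * (r * L n) := by gcongr
  have h3 : a / 2 * L n * r < sNum B n * r := by gcongr
  have h4 : a / 2 * c ≤ e := by nlinarith
  have : 0 < a / 2 * c := by positivity
  linarith

end Final

/-- **Theorem 3.3.** Let `Ω ⊂ ℝ^m` be a bounded domain with infinitely smooth boundary,
let `B` be a non-negative injective compact operator on `L²(Ω)` inverting `-Δ` in the
distributional sense, with `s n (B) / L n → a` for a slowly varying function `L` and
some `0 < a < ∞`, and let `K ∈ S_q` (`q > 0`) have range consisting of harmonic
functions.  Then `B + K` has a nonzero eigenvalue, i.e. the corresponding well-defined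
restriction `L_K` of the maximal operator is not Volterra. -/
theorem statement5 {m : ℕ} (Ω : Set (EuclideanSpace ℝ (Fin m)))
    (hΩopen : IsOpen Ω) (hΩconn : IsConnected Ω) (hΩbdd : Bornology.IsBounded Ω)
    (hΩsmooth : HasSmoothBoundary Ω)
    (B K : Lp ℂ 2 (volume.restrict Ω) →L[ℂ] Lp ℂ 2 (volume.restrict Ω))
    (hBpos : B.IsPositive) (hBinj : Function.Injective ⇑B)
    (hBcompact : IsCompactOperator (⇑B))
    (hBinv : ∀ f : Lp ℂ 2 (volume.restrict Ω), WeakNegLapEq Ω (⇑(B f)) (⇑f))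
    (b : ℝ) (L : ℝ → ℝ) (hL : SlowlyVarying b L)
    (a q : ℝ) (ha0 : 0 < a) (hq0 : 0 < q)
    (hBL : Tendsto (fun n : ℕ => sNum B n / L n) atTop (𝓝 a))
    (hKq : Summable (fun n : ℕ => sNum K (n + 1) ^ q))
    (hKharm : ∀ f : Lp ℂ 2 (volume.restrict Ω), WeakHarmonicOn Ω (⇑(K f))) :
    ∃ μ : ℂ, μ ≠ 0 ∧
      Module.End.HasEigenvalue ((B + K : Lp ℂ 2 (volume.restrict Ω) →L[ℂ]
        Lp ℂ 2 (volume.restrict Ω)) : Lp ℂ 2 (volume.restrict Ω) →ₗ[ℂ]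
        Lp ℂ 2 (volume.restrict Ω)) μ := by
  exact abstract_thm B K hBpos.isSelfAdjoint hBcompact hL.b_pos hL.pos hL.contDiff hL.slow a q
    ha0 hq0 hBL hKq
end

section
/- Let H = L²((0, 1), t dt) be the Hilbert space of complex functions on (0, 1) square-integrable with respect to the weight t. The integral operator V defined by (Vf)(r) = ∫_0^r ln(t/r) f(t) t dt is a Volterra operator on H: it is compact (indeed Hilbert–Schmidt) and quasinilpotent, i.e., its spectral radius is zero. Consequently, the well-defined restriction L_K of the maximal operator generated by -u'' - (1/r)u' on L²((0,1), t dt), whose inverse is V, is Volterra. -/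
open Filter Topology MeasureTheory

/-- The weighted Lebesgue measure `t dt` on `(0, 1)`. -/
noncomputable def weightedMeasure : Measure ℝ :=
  (volume.restrict (Set.Ioo (0 : ℝ) 1)).withDensity fun t => ENNReal.ofReal t

namespace Stmt17

lemma ae_w_iff (p : ℝ → Prop) :
    (∀ᵐ t ∂weightedMeasure, p t) ↔ ∀ᵐ t, t ∈ Set.Ioo (0:ℝ) 1 → p t := by
  unfold weightedMeasure
  rw [ae_withDensity_iff (by fun_prop), ae_restrict_iff' measurableSet_Ioo]
  refine eventually_congr (Eventually.of_forall fun t => ?_)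
  constructor
  · intro h ht
    exact h ht (by simpa using ht.1)
  · intro h ht _
    exact h ht

lemma ae_w_mem : ∀ᵐ t ∂weightedMeasure, t ∈ Set.Ioo (0:ℝ) 1 := by
  rw [ae_w_iff]; exact Eventually.of_forall fun t h => h

lemma w_univ : weightedMeasure Set.univ ≤ 1 := by
  unfold weightedMeasure
  rw [withDensity_apply _ MeasurableSet.univ, Measure.restrict_univ]
  calc ∫⁻ t in Set.Ioo (0:ℝ) 1, ENNReal.ofReal t ≤ ∫⁻ t in Set.Ioo (0:ℝ) 1, 1 := by
        refine setLIntegral_mono' measurableSet_Ioo fun t ht => ?_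
        simpa using ht.2.le
    _ = 1 := by simp

instance : IsFiniteMeasure weightedMeasure := ⟨lt_of_le_of_lt w_univ ENNReal.one_lt_top⟩

lemma norm_le_bd (f : Lp ℂ 2 weightedMeasure) {C : ℝ} (hC : 0 ≤ C)
    (h : ∀ᵐ r ∂weightedMeasure, ‖f r‖ ≤ C) : ‖f‖ ≤ C := by
  refine (Lp.norm_le_of_ae_bound hC h).trans ?_
  have : measureUnivNNReal weightedMeasure ≤ 1 := by
    rw [← ENNReal.coe_le_coe, coe_measureUnivNNReal]; exact_mod_cast w_univ
  have h2 : (measureUnivNNReal weightedMeasure : ℝ) ^ (2:ENNReal).toReal⁻¹ ≤ 1 :=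
    Real.rpow_le_one (by positivity) (by exact_mod_cast this) (by positivity)
  have := mul_le_mul_of_nonneg_right h2 hC
  simpa using this

/-- `L²` bound. -/
lemma eLp_le (h : ℝ → ℂ) (r M : ℝ) (hM : 0 ≤ M) (hr : 0 ≤ r)
    (H : ∀ t ∈ Set.Ioo (0:ℝ) 1, t ≤ r → ‖h t‖ ^ 2 * t ≤ M ^ 2 * r)
    (H0 : ∀ t ∈ Set.Ioo (0:ℝ) 1, r < t → h t = 0) (hm : Measurable h) :
    eLpNorm h 2 weightedMeasure ≤ ENNReal.ofReal (M * r) := by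
  have key : ∫⁻ t, ‖h t‖ₑ ^ (2:ℝ) ∂weightedMeasure ≤ ENNReal.ofReal (M * r) ^ (2:ℝ) := by
    unfold weightedMeasure
    rw [lintegral_withDensity_eq_lintegral_mul _ (by fun_prop) (by fun_prop)]
    calc ∫⁻ t in Set.Ioo (0:ℝ) 1, ((fun t => ENNReal.ofReal t) * fun t => ‖h t‖ₑ ^ (2:ℝ)) t
        ≤ ∫⁻ t in Set.Ioo (0:ℝ) 1, (Set.Ioc 0 r).indicator (fun _ => ENNReal.ofReal (M ^ 2 * r)) t := by
          refine setLIntegral_mono' measurableSet_Ioo fun t ht => ?_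
          by_cases htr : t ≤ r
          · rw [Set.indicator_of_mem (show t ∈ Set.Ioc 0 r from ⟨ht.1, htr⟩)]
            have := H t ht htr
            simp only [Pi.mul_apply, ← ofReal_norm]
            rw [ENNReal.ofReal_rpow_of_nonneg (norm_nonneg _) (by norm_num), ← ENNReal.ofReal_mul ht.1.le]
            apply ENNReal.ofReal_le_ofReal
            rw [Real.rpow_two]; linarith
          · simp [H0 t ht (not_le.1 htr)]
      _ ≤ ∫⁻ t, (Set.Ioc 0 r).indicator (fun _ => ENNReal.ofReal (M ^ 2 * r)) t :=
          setLIntegral_le_lintegral _ _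
      _ = ENNReal.ofReal (M * r) ^ (2:ℝ) := by
          rw [lintegral_indicator measurableSet_Ioc, setLIntegral_const, Real.volume_Ioc,
            ENNReal.ofReal_rpow_of_nonneg (by positivity) (by norm_num), ← ENNReal.ofReal_mul (by positivity)]
          congr 1
          rw [Real.rpow_two]; ring
  rw [eLpNorm_eq_lintegral_rpow_enorm_toReal (by norm_num) (by norm_num)]
  simp only [ENNReal.toReal_ofNat]
  rw [one_div, ENNReal.rpow_inv_le_iff (by norm_num)]
  exact key

noncomputable def K (r t : ℝ) : ℂ := (Set.Iic r).indicator (fun t => ((Real.log (t / r) : ℝ) : ℂ)) t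

lemma K_meas (r : ℝ) : Measurable (K r) :=
  Measurable.indicator (by fun_prop) measurableSet_Iic

lemma log_sq_bd (x : ℝ) (h0 : 0 < x) (h1 : x ≤ 1) : (Real.log x) ^ 2 * x ≤ 4 := by
  have h := Real.abs_log_mul_self_lt (√x) (Real.sqrt_pos.2 h0) (Real.sqrt_le_one.2 h1)
  rw [Real.log_sqrt h0.le] at h
  have h2 := (sq_le_one_iff_abs_le_one _).2 h.le
  rw [mul_pow, Real.sq_sqrt h0.le] at h2
  nlinarith

lemma K_norm (r : ℝ) (hr : 0 ≤ r) : eLpNorm (K r) 2 weightedMeasure ≤ ENNReal.ofReal (2 * r) := by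
  refine eLp_le _ _ _ (by norm_num) hr ?_ ?_ (K_meas r)
  · intro t ht htr
    have hr0 : 0 < r := ht.1.trans_le htr
    have h := log_sq_bd (t / r) (div_pos ht.1 hr0) ((div_le_one hr0).2 htr)
    rw [K, Set.indicator_of_mem (by simpa using htr), Complex.norm_real, Real.norm_eq_abs, sq_abs]
    rw [← mul_div_assoc, div_le_iff₀ hr0] at h
    linarith
  · intro t ht htr
    rw [K, Set.indicator_of_notMem (by simpa using htr)]

lemma K_memLp (r : ℝ) (hr : 0 ≤ r) : MemLp (K r) 2 weightedMeasure :=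
  ⟨(K_meas r).aestronglyMeasurable, (K_norm r hr).trans_lt ENNReal.ofReal_lt_top⟩

lemma K_diff (a r : ℝ) (ha : 0 < a) (har : a ≤ r) :
    eLpNorm (K r - K a) 2 weightedMeasure ≤ ENNReal.ofReal ((r - a) / a * r) := by
  have hr : 0 < r := ha.trans_le har
  have hlog : Real.log r - Real.log a ≤ (r - a) / a := by
    rw [← Real.log_div hr.ne' ha.ne', sub_div, div_self ha.ne']
    exact Real.log_le_sub_one_of_pos (by positivity)
  have hM : 0 ≤ (r - a) / a := div_nonneg (by linarith) ha.le
  refine eLp_le _ _ _ hM hr.le ?_ ?_ ((K_meas r).sub (K_meas a))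
  · intro t ht htr
    have h1 : ‖(K r - K a) t‖ ≤ (r - a) / a := by
      refine le_trans ?_ hlog
      by_cases hta : t ≤ a
      · rw [Pi.sub_apply, K, K, Set.indicator_of_mem (by simpa using htr), Set.indicator_of_mem (by simpa using hta),
          ← Complex.ofReal_sub, Complex.norm_real, Real.norm_eq_abs, Real.log_div ht.1.ne' hr.ne',
          Real.log_div ht.1.ne' ha.ne', abs_le]
        have := Real.log_le_log ha har
        constructor <;> linarith
      · rw [Pi.sub_apply, K, K, Set.indicator_of_mem (by simpa using htr), Set.indicator_of_notMem (by simpa using hta),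
          sub_zero, Complex.norm_real, Real.norm_eq_abs, Real.log_div ht.1.ne' hr.ne', abs_le]
        have := Real.log_le_log ha (not_le.1 hta).le
        have := Real.log_le_log ht.1 htr
        constructor <;> linarith
    have h2 := pow_le_pow_left₀ (norm_nonneg _) h1 2
    exact mul_le_mul h2 htr ht.1.le (by positivity)
  · intro t ht htr
    rw [Pi.sub_apply, K, K, Set.indicator_of_notMem (by simpa using htr),
      Set.indicator_of_notMem (by simpa using har.trans_lt htr), sub_zero]

/-- kernel section as element of `L²` -/
noncomputable def KL (r : ℝ) : Lp ℂ 2 weightedMeasure :=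
  if hr : 0 ≤ r then (K_memLp r hr).toLp _ else 0

lemma KL_norm (r : ℝ) (hr : 0 ≤ r) : ‖KL r‖ ≤ 2 * r := by
  rw [KL, dif_pos hr, Lp.norm_toLp]
  exact ENNReal.toReal_le_of_le_ofReal (by positivity) (K_norm r hr)

lemma KL_zero : KL 0 = 0 := by
  have := KL_norm 0 le_rfl
  simpa using this

lemma KL_diff (a r : ℝ) (ha : 0 < a) (har : a ≤ r) : ‖KL r - KL a‖ ≤ (r - a) / a * r := by
  have hr : 0 < r := ha.trans_le har
  rw [KL, dif_pos hr.le, KL, dif_pos ha.le, ← MemLp.toLp_sub, Lp.norm_toLp]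
  exact ENNReal.toReal_le_of_le_ofReal
    (mul_nonneg (div_nonneg (by linarith) ha.le) hr.le) (K_diff a r ha har)

lemma formula (f : Lp ℂ 2 weightedMeasure) (r : ℝ) (hr : r ∈ Set.Ioo (0:ℝ) 1) :
    ∫ t in (0 : ℝ)..r, ((Real.log (t / r) : ℝ) : ℂ) * f t * (t : ℂ) = inner ℂ (KL r) f := by
  rw [L2.inner_def, KL, dif_pos hr.1.le]
  have h1 : ∫ a, inner ℂ (((K_memLp r hr.1.le).toLp (K r) : Lp ℂ 2 weightedMeasure) a) (f a) ∂weightedMeasure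
      = ∫ a, K r a * f a ∂weightedMeasure := by
    apply integral_congr_ae
    filter_upwards [(K_memLp r hr.1.le).coeFn_toLp] with t ht
    rw [ht, RCLike.inner_apply, mul_comm]
    congr 1
    unfold K
    by_cases h : t ∈ Set.Iic r
    · simp only [Set.indicator_of_mem h]; exact Complex.conj_ofReal _
    · simp only [Set.indicator_of_notMem h, map_zero]
  rw [h1]
  conv_rhs => unfold weightedMeasure
  rw [integral_withDensity_eq_integral_toReal_smul (by fun_prop) (by simp)]
  rw [intervalIntegral.integral_of_le hr.1.le, ← integral_indicator measurableSet_Ioc,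
    ← integral_indicator measurableSet_Ioo]
  congr 1
  ext t
  by_cases h : t ∈ Set.Ioc 0 r
  · rw [Set.indicator_of_mem h, Set.indicator_of_mem (show t ∈ Set.Ioo 0 1 from ⟨h.1, h.2.trans_lt hr.2⟩), K,
      Set.indicator_of_mem (by simpa using h.2), ENNReal.toReal_ofReal h.1.le, Complex.real_smul, mul_comm]
    rfl
  · rw [Set.indicator_of_notMem h]
    by_cases h' : t ∈ Set.Ioo (0:ℝ) 1
    · rw [Set.indicator_of_mem h', K, Set.indicator_of_notMem (by
        intro h2; exact h ⟨h'.1, h2⟩)]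
      simp
    · rw [Set.indicator_of_notMem h']

/-- error of the grid approximation -/
lemma grid (N : ℕ) (hN : 0 < N) (r : ℝ) (hr : r ∈ Set.Ioo (0:ℝ) 1) :
    ‖KL r - KL ((⌊N * r⌋₊ : ℝ) / N)‖ ≤ 2 / N := by
  have hN' : (0:ℝ) < N := by exact_mod_cast hN
  have hp : 0 ≤ N * r := by have := hr.1; positivity
  have h1 := Nat.floor_le hp
  have h2 := Nat.lt_floor_add_one ((N:ℝ) * r)
  rcases Nat.eq_zero_or_pos ⌊N * r⌋₊ with h | h
  · rw [h] at h2 ⊢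
    simp only [Nat.cast_zero, zero_div, KL_zero, sub_zero]
    refine (KL_norm r hr.1.le).trans ?_
    rw [le_div_iff₀ hN']
    push_cast at h2
    nlinarith
  · have hm : (1:ℝ) ≤ ⌊N * r⌋₊ := by exact_mod_cast h
    generalize (⌊N * r⌋₊ : ℝ) = m at *
    have hle : m / N ≤ r := by rw [div_le_iff₀ hN']; linarith
    have hm0 : 0 < m := by linarith
    refine (KL_diff (m / N) r (by positivity) hle).trans ?_
    have e : (r - m / N) / (m / N) * r = (N * r - m) * (N * r) / m / N := by
      field_simp
    rw [e]
    apply div_le_div_of_nonneg_right _ hN'.le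
    rw [div_le_iff₀ hm0]
    nlinarith


/-- Synthesis operator: piecewise constant functions on the grid of size `N+1`. -/
lemma G_memLp (N : ℕ) (c : Fin (N + 1) → ℂ) :
    MemLp (fun r : ℝ => c (Fin.ofNat (N + 1) ⌊((N + 1 : ℕ) : ℝ) * r⌋₊)) 2 weightedMeasure := by
  refine MemLp.of_bound (C := ‖c‖) ?_ (Eventually.of_forall fun r => norm_le_pi_norm c _)
  apply Measurable.aestronglyMeasurable
  have h : Measurable fun m : ℕ => c (Fin.ofNat (N + 1) m) := measurable_from_top
  exact h.comp (Nat.measurable_floor.comp (measurable_id.const_mul _))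

noncomputable def G (N : ℕ) : (Fin (N + 1) → ℂ) →ₗ[ℂ] Lp ℂ 2 weightedMeasure where
  toFun c := (G_memLp N c).toLp _
  map_add' c d := by rw [← MemLp.toLp_add]; rfl
  map_smul' a c := by rw [RingHom.id_apply, ← MemLp.toLp_const_smul]; rfl

noncomputable def A (N : ℕ) : Lp ℂ 2 weightedMeasure →L[ℂ] (Fin (N + 1) → ℂ) :=
  ContinuousLinearMap.pi fun i => innerSL ℂ (KL ((i : ℝ) / ((N + 1 : ℕ) : ℝ)))

noncomputable def F (N : ℕ) : Lp ℂ 2 weightedMeasure →L[ℂ] Lp ℂ 2 weightedMeasure :=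
  (LinearMap.toContinuousLinearMap (G N)).comp (A N)

lemma F_compact (N : ℕ) : IsCompactOperator (F N) :=
  IsCompactOperator.clm_comp (f := A N)
    (isCompactOperator_of_locallyCompactSpace_dom (A N)) (LinearMap.toContinuousLinearMap (G N))

lemma F_rank (N : ℕ) :
    Module.rank ℂ (LinearMap.range (F N : Lp ℂ 2 weightedMeasure →ₗ[ℂ] Lp ℂ 2 weightedMeasure))
      < ((N + 1 + 1 : ℕ) : Cardinal) := by
  have h1 : LinearMap.range (F N : Lp ℂ 2 weightedMeasure →ₗ[ℂ] Lp ℂ 2 weightedMeasure)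
      ≤ LinearMap.range (G N) := by
    rintro _ ⟨x, rfl⟩
    exact ⟨A N x, rfl⟩
  have h2 : Module.rank ℂ (LinearMap.range (G N)) ≤ ((N + 1 : ℕ) : Cardinal) := by
    have := rank_range_le (G N)
    simpa using this
  refine ((Submodule.rank_mono h1).trans h2).trans_lt ?_
  exact_mod_cast Nat.lt_succ_self _

lemma V_sub_F
    (V : Lp ℂ 2 weightedMeasure →L[ℂ] Lp ℂ 2 weightedMeasure)
    (hV : ∀ f : Lp ℂ 2 weightedMeasure, ∀ᵐ r ∂weightedMeasure,
      (V f) r = ∫ t in (0 : ℝ)..r, ((Real.log (t / r) : ℝ) : ℂ) * f t * (t : ℂ)) (N : ℕ) :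
    ‖V - F N‖ ≤ 2 / ((N + 1 : ℕ) : ℝ) := by
  refine ContinuousLinearMap.opNorm_le_bound _ (by positivity) fun f => ?_
  refine norm_le_bd _ (by positivity) ?_
  rw [ContinuousLinearMap.sub_apply]
  filter_upwards [hV f, ae_w_mem, Lp.coeFn_sub (V f) (F N f),
    (G_memLp N (A N f)).coeFn_toLp] with r h1 hr h2 h3
  have h4 : (F N f : Lp ℂ 2 weightedMeasure) r
      = inner ℂ (KL ((⌊((N + 1 : ℕ) : ℝ) * r⌋₊ : ℝ) / ((N + 1 : ℕ) : ℝ))) f := by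
    refine Eq.trans h3 ?_
    have hlt : ⌊((N + 1 : ℕ) : ℝ) * r⌋₊ < N + 1 := by
      rw [Nat.floor_lt (by have := hr.1; positivity)]
      have hN : (0:ℝ) < ((N + 1 : ℕ) : ℝ) := by positivity
      nlinarith [hr.2]
    simp only [A, ContinuousLinearMap.pi_apply, innerSL_apply_apply, Fin.val_ofNat,
      Nat.mod_eq_of_lt hlt]
  rw [h2, Pi.sub_apply, h1, formula f r hr, h4, ← inner_sub_left]
  refine (norm_inner_le_norm _ _).trans ?_
  exact mul_le_mul_of_nonneg_right (grid (N + 1) (Nat.succ_pos _) r hr) (norm_nonneg _)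

lemma V_pow
    (V : Lp ℂ 2 weightedMeasure →L[ℂ] Lp ℂ 2 weightedMeasure)
    (hV : ∀ f : Lp ℂ 2 weightedMeasure, ∀ᵐ r ∂weightedMeasure,
      (V f) r = ∫ t in (0 : ℝ)..r, ((Real.log (t / r) : ℝ) : ℂ) * f t * (t : ℂ)) (n : ℕ)
    (f : Lp ℂ 2 weightedMeasure) :
    ∀ᵐ r ∂weightedMeasure, ‖((V ^ (n + 1)) f : Lp ℂ 2 weightedMeasure) r‖
      ≤ 2 * ‖f‖ / (n.factorial : ℝ) * r ^ n := by
  induction n with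
  | zero =>
    rw [zero_add, pow_one]
    filter_upwards [hV f, ae_w_mem] with r h1 hr
    rw [h1, formula f r hr]
    refine (norm_inner_le_norm _ _).trans ?_
    have := KL_norm r hr.1.le
    have h3 : ‖KL r‖ ≤ 2 := by linarith [hr.2]
    simpa using mul_le_mul_of_nonneg_right h3 (norm_nonneg f)
  | succ n ih =>
    rw [pow_succ' V (n + 1), ContinuousLinearMap.mul_apply]
    set g := (V ^ (n + 1)) f with hg
    rw [ae_w_iff] at ih
    filter_upwards [hV g, ae_w_mem] with r h1 hr
    rw [h1]
    set C : ℝ := 2 * ‖f‖ / (n.factorial : ℝ) with hC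
    have hC0 : 0 ≤ C := by positivity
    have hb : ‖∫ t in (0 : ℝ)..r, ((Real.log (t / r) : ℝ) : ℂ) * g t * (t : ℂ)‖
        ≤ ∫ t in (0 : ℝ)..r, C * t ^ n := by
      refine intervalIntegral.norm_integral_le_of_norm_le hr.1.le ?_
        (Continuous.intervalIntegrable (by fun_prop) _ _)
      filter_upwards [ih] with t ht htr
      have ht' := ht ⟨htr.1, htr.2.trans_lt hr.2⟩
      have hl := (Real.abs_log_mul_self_lt (t / r) (div_pos htr.1 hr.1)
        ((div_le_one hr.1).2 htr.2)).le
      rw [← mul_div_assoc, abs_div, abs_of_pos hr.1, div_le_one hr.1] at hl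
      have hl1 : |Real.log (t / r) * t| ≤ 1 := hl.trans hr.2.le
      have e : ‖((Real.log (t / r) : ℝ) : ℂ) * g t * (t : ℂ)‖ = |Real.log (t / r) * t| * ‖g t‖ := by
        rw [norm_mul, norm_mul, Complex.norm_real, Complex.norm_real, Real.norm_eq_abs,
          Real.norm_eq_abs, abs_mul]
        ring
      rw [e]
      calc |Real.log (t / r) * t| * ‖g t‖ ≤ 1 * ‖g t‖ :=
            mul_le_mul_of_nonneg_right hl1 (norm_nonneg _)
        _ ≤ C * t ^ n := by rw [one_mul]; exact ht'
    refine hb.trans (le_of_eq ?_)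
    rw [intervalIntegral.integral_const_mul, integral_pow, hC, Nat.factorial_succ]
    have : (n.factorial : ℝ) ≠ 0 := by positivity
    push_cast
    field_simp
    simp

lemma V_pow_norm
    (V : Lp ℂ 2 weightedMeasure →L[ℂ] Lp ℂ 2 weightedMeasure)
    (hV : ∀ f : Lp ℂ 2 weightedMeasure, ∀ᵐ r ∂weightedMeasure,
      (V f) r = ∫ t in (0 : ℝ)..r, ((Real.log (t / r) : ℝ) : ℂ) * f t * (t : ℂ)) (n : ℕ) :
    ‖V ^ (n + 1)‖ ≤ 2 / (n.factorial : ℝ) := by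
  refine ContinuousLinearMap.opNorm_le_bound _ (by positivity) fun f => ?_
  refine norm_le_bd _ (by positivity) ?_
  filter_upwards [V_pow V hV n f, ae_w_mem] with r h hr
  refine h.trans ?_
  have h1 : r ^ n ≤ 1 := pow_le_one₀ hr.1.le hr.2.le
  calc 2 * ‖f‖ / (n.factorial : ℝ) * r ^ n ≤ 2 * ‖f‖ / (n.factorial : ℝ) * 1 :=
        mul_le_mul_of_nonneg_left h1 (by positivity)
    _ = 2 / (n.factorial : ℝ) * ‖f‖ := by ring

lemma V_radius
    (V : Lp ℂ 2 weightedMeasure →L[ℂ] Lp ℂ 2 weightedMeasure)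
    (hV : ∀ f : Lp ℂ 2 weightedMeasure, ∀ᵐ r ∂weightedMeasure,
      (V f) r = ∫ t in (0 : ℝ)..r, ((Real.log (t / r) : ℝ) : ℂ) * f t * (t : ℂ)) :
    spectralRadius ℂ V = 0 := by
  rw [spectralRadius]
  simp only [ENNReal.iSup_eq_zero]
  intro z hz
  by_contra hne
  have hz0 : 0 < ‖z‖ := by
    rw [norm_pos_iff]
    rintro rfl
    simp at hne
  have hb : ∀ n : ℕ, ‖z‖ ≤ 2 * ((‖z‖⁻¹) ^ n / (n.factorial : ℝ)) *
      ‖(1 : Lp ℂ 2 weightedMeasure →L[ℂ] Lp ℂ 2 weightedMeasure)‖ := by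
    intro n
    have h1 := spectrum.norm_le_norm_mul_of_mem (spectrum.pow_mem_pow V (n + 1) hz)
    rw [norm_pow] at h1
    have h2 := h1.trans (mul_le_mul_of_nonneg_right (V_pow_norm V hV n) (norm_nonneg _))
    have e : ‖z‖ = (‖z‖⁻¹) ^ n * ‖z‖ ^ (n + 1) := by
      rw [pow_succ, ← mul_assoc, ← mul_pow, inv_mul_cancel₀ hz0.ne', one_pow, one_mul]
    calc ‖z‖ = (‖z‖⁻¹) ^ n * ‖z‖ ^ (n + 1) := e
      _ ≤ (‖z‖⁻¹) ^ n * _ := mul_le_mul_of_nonneg_left h2 (by positivity)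
      _ = _ := by ring
  have ht := ((FloorSemiring.tendsto_pow_div_factorial_atTop (‖z‖⁻¹)).const_mul 2).mul_const
    ‖(1 : Lp ℂ 2 weightedMeasure →L[ℂ] Lp ℂ 2 weightedMeasure)‖
  have := ge_of_tendsto' ht hb
  simp only [mul_zero, zero_mul] at this
  linarith

end Stmt17

/-- The integral operator `(Vf)(r) = ∫_0^r ln(t/r) f t · t dt` is a Volterra operator on
the weighted space `L²((0,1), t dt)`: it is compact (indeed Hilbert–Schmidt, i.e. in
`S₂`) and quasinilpotent (its spectral radius is zero).  Consequently the well-defined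
restriction `L_K` of the maximal operator generated by `-u'' - u'/r`, whose inverse is
`V`, is Volterra. -/
theorem statement17
    (V : Lp ℂ 2 weightedMeasure →L[ℂ] Lp ℂ 2 weightedMeasure)
    (hV : ∀ f : Lp ℂ 2 weightedMeasure, ∀ᵐ r ∂weightedMeasure,
      (V f) r = ∫ t in (0 : ℝ)..r, ((Real.log (t / r) : ℝ) : ℂ) * f t * (t : ℂ)) :
    IsCompactOperator (⇑V) ∧ Summable (fun n : ℕ => sNum V (n + 1) ^ (2 : ℝ)) ∧
      spectralRadius ℂ V = 0 := by
  have hF := Stmt17.V_sub_F V hV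
  refine ⟨?_, ?_, Stmt17.V_radius V hV⟩
  · refine isCompactOperator_of_tendsto (l := atTop) (F := Stmt17.F) ?_
      (Eventually.of_forall Stmt17.F_compact)
    rw [tendsto_iff_norm_sub_tendsto_zero]
    refine squeeze_zero (fun _ => norm_nonneg _) (fun N => (norm_sub_rev _ _).trans_le (hF N)) ?_
    exact (tendsto_const_div_atTop_nhds_zero_nat (2 : ℝ)).comp (tendsto_add_atTop_nat 1)
  · rw [← summable_nat_add_iff 1]
    have hs : Summable fun n : ℕ => (4 : ℝ) * (1 / ((n + 1 : ℕ) : ℝ) ^ 2) :=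
      ((summable_nat_add_iff 1).2
        (Real.summable_one_div_nat_pow.2 (by norm_num : 1 < 2))).mul_left 4
    have h0 : ∀ m, 0 ≤ sNum V m := fun m => Real.iInf_nonneg fun _ => norm_nonneg _
    refine Summable.of_nonneg_of_le (fun n => Real.rpow_nonneg (h0 _) _) (fun n => ?_) hs
    have h1 : sNum V (n + 1 + 1) ≤ 2 / ((n + 1 : ℕ) : ℝ) := by
      refine le_trans ?_ (hF n)
      exact ciInf_le (f := fun F : {F : Lp ℂ 2 weightedMeasure →L[ℂ] Lp ℂ 2 weightedMeasure //
        Module.rank ℂ (LinearMap.range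
          (F : Lp ℂ 2 weightedMeasure →ₗ[ℂ] Lp ℂ 2 weightedMeasure))
          < ((n + 1 + 1 : ℕ) : Cardinal)} => ‖V - F.1‖)
        ⟨0, by rintro _ ⟨F, rfl⟩; exact norm_nonneg _⟩ ⟨Stmt17.F n, Stmt17.F_rank n⟩
    rw [Real.rpow_two]
    calc sNum V (n + 1 + 1) ^ 2 ≤ (2 / ((n + 1 : ℕ) : ℝ)) ^ 2 := pow_le_pow_left₀ (h0 _) h1 2
      _ = 4 * (1 / ((n + 1 : ℕ) : ℝ) ^ 2) := by rw [div_pow]; ring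
end
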